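/- There exists a universal constant c > 0 with the following property. Let P be a finite set of s polynomials in ℝ[X_1,…,X_k], each of degree at most d, such that any k+1 pairwise distinct polynomials of P have no common zero in ℝ^k and any k pairwise distinct polynomials of P have at most finitely many common zeros in ℝ^k (strong k-general position), and let S be a P-closed set contained in the sphere {x ∈ ℝ^k : x_1² + ⋯ + x_k² = r²} for some r > 0. Then S can be written as the union of at most s^{(k+1)²}·d^{c·k⁵} subsets of ℝ^k, each of which is closed, bounded and contractible. -/

import Mathlib

open MvPolynomial Set

/-- The basic closed set `{P = 0}`, `{P ≥ 0}` or `{P ≤ 0}` according to `r = 0, 1, -1`. -/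
def basicClosedSet {k : ℕ} (P : MvPolynomial (Fin k) ℝ) (r : SignType) :
    Set (Fin k → ℝ) :=
  match r with
  | SignType.zero => {x | eval x P = 0}
  | SignType.pos => {x | 0 ≤ eval x P}
  | SignType.neg => {x | eval x P ≤ 0}

/-- Polynomials separate the points of a finite set: every function on it is polynomial. -/
lemma exists_polynomial_eq_single {k : ℕ} (V : Finset (Fin k → ℝ)) (v : Fin k → ℝ) :
    ∃ p : MvPolynomial (Fin k) ℝ, eval v p ≠ 0 ∧ ∀ w ∈ V, w ≠ v → eval w p = 0 := by
  classical
  refine ⟨∏ w ∈ V.erase v, ∑ i, (X i - C (w i)) ^ 2, ?_, ?_⟩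
  · rw [map_prod, Finset.prod_ne_zero_iff]
    intro w hw h
    simp only [map_sum, map_pow, map_sub, eval_X, eval_C] at h
    rw [Finset.sum_eq_zero_iff_of_nonneg (fun i _ => sq_nonneg _)] at h
    refine (Finset.mem_erase.1 hw).1 (funext fun i => ?_)
    have := h i (Finset.mem_univ i)
    have := pow_eq_zero_iff (two_ne_zero) |>.1 this
    linarith
  · intro w hw hwv
    rw [map_prod]
    refine Finset.prod_eq_zero (Finset.mem_erase.2 ⟨hwv, hw⟩) ?_
    simp

/-- A system `x_i ^ D = g_i(x)` with `deg g_i < D` has at most `D ^ k` real solutions. -/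
lemma card_le_of_pow_eq {k D : ℕ} (g : Fin k → MvPolynomial (Fin k) ℝ)
    (hg : ∀ i, (g i).totalDegree < D) (V : Finset (Fin k → ℝ))
    (hV : ∀ v ∈ V, ∀ i, v i ^ D = eval v (g i)) : V.card ≤ D ^ k := by
  classical
  let ev : MvPolynomial (Fin k) ℝ →ₗ[ℝ] (V → ℝ) :=
    { toFun := fun p v => eval v.1 p
      map_add' := fun p q => by ext; simp
      map_smul' := fun c p => by ext; simp [smul_eval] }
  let b : (Fin k → Fin D) → (V → ℝ) := fun a v => ∏ i, v.1 i ^ (a i : ℕ)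
  have key : ∀ (n : ℕ) (p : MvPolynomial (Fin k) ℝ), p.totalDegree ≤ n →
      ev p ∈ Submodule.span ℝ (Set.range b) := by
    intro n
    induction n using Nat.strong_induction_on with
    | _ n ih =>
      intro p hp
      rw [p.as_sum, map_sum]
      refine Submodule.sum_mem _ fun m hm => ?_
      have hmn : (m.sum fun _ e => e) ≤ n := (le_totalDegree hm).trans hp
      have hmon : monomial m (coeff m p) = (coeff m p) • monomial m (1 : ℝ) := by
        rw [smul_monomial]; simp
      rw [hmon, map_smul]
      refine Submodule.smul_mem _ _ ?_
      by_cases h : ∀ i, m i < D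
      · refine Submodule.subset_span ⟨fun i => ⟨m i, h i⟩, ?_⟩
        ext v
        simp [ev, b, eval_monomial, Finsupp.prod_fintype]
      · push Not at h
        obtain ⟨i, hi⟩ := h
        have hD : 0 < D := lt_of_le_of_lt (Nat.zero_le _) (hg i)
        have hle : Finsupp.single i D ≤ m := by
          rw [Finsupp.single_le_iff]; exact hi
        set m' := m - Finsupp.single i D with hm'
        have hmm : m = m' + Finsupp.single i D := (tsub_add_cancel_of_le hle).symm
        have hev : ev (monomial m 1) = ev (monomial m' 1 * g i) := by
          ext v
          have h1 : (monomial m (1 : ℝ)) = monomial m' 1 * X i ^ D := by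
            rw [hmm, X_pow_eq_monomial, monomial_mul, one_mul]
          simp only [ev, LinearMap.coe_mk, AddHom.coe_mk]
          rw [h1, map_mul, map_mul, map_pow, eval_X, hV v.1 v.2 i]
        rw [hev]
        have hdeg : (monomial m' (1 : ℝ) * g i).totalDegree < n := by
          refine (totalDegree_mul _ _).trans_lt ?_
          rw [totalDegree_monomial _ one_ne_zero]
          have hs : (m.sum fun _ e => e) = (m'.sum fun _ e => e) + D := by
            rw [hmm, Finsupp.sum_add_index' (by simp) (by simp), Finsupp.sum_single_index rfl]
          have := hg i
          omega
        exact ih _ hdeg _ le_rfl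
  have hspan : Submodule.span ℝ (Set.range b) = ⊤ := by
    rw [eq_top_iff, ← (Pi.basisFun ℝ V).span_eq, Submodule.span_le]
    rintro _ ⟨v, rfl⟩
    obtain ⟨p, hp, hp'⟩ := exists_polynomial_eq_single V v.1
    have : (Pi.basisFun ℝ V) v = (eval v.1 p)⁻¹ • ev p := by
      ext w
      by_cases hw : w = v
      · subst hw
        simp [ev, hp]
      · have h1 := hp' w.1 w.2 (fun h => hw (Subtype.ext h))
        simp [ev, h1, hw]
    rw [this]
    exact Submodule.smul_mem _ _ (key _ p le_rfl)
  have h1 := finrank_range_le_card (R := ℝ) b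
  rw [Set.finrank, hspan, finrank_top, Module.finrank_fintype_fun_eq_card] at h1
  simpa using h1

lemma exists_pos_forall_le {ι : Type*} [Finite ι] (f : ι → ℝ) (hf : ∀ i, 0 < f i) :
    ∃ ε : ℝ, 0 < ε ∧ ∀ i, ε ≤ f i := by
  cases isEmpty_or_nonempty ι
  · exact ⟨1, one_pos, fun i => isEmptyElim i⟩
  · obtain ⟨i, hi⟩ := Finite.exists_min f
    exact ⟨f i, hf i, hi⟩

lemma totalDegree_pderiv_le {k : ℕ} (j : Fin k) (p : MvPolynomial (Fin k) ℝ) :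
    (pderiv j p).totalDegree ≤ p.totalDegree := by
  refine Finset.sup_le fun m hm => ?_
  rw [mem_support_iff, coeff_pderiv] at hm
  have h1 : m + Finsupp.single j 1 ∈ p.support := mem_support_iff.2 (left_ne_zero_of_mul hm)
  have h2 := le_totalDegree h1
  rw [Finsupp.sum_add_index' (by simp) (by simp), Finsupp.sum_single_index rfl] at h2
  omega

lemma hasDerivAt_eval_update {k : ℕ} (j : Fin k) (z : Fin k → ℝ) (p : MvPolynomial (Fin k) ℝ)
    (t : ℝ) : HasDerivAt (fun t => eval (Function.update z j t) p)
      (eval (Function.update z j t) (pderiv j p)) t := by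
  induction p using MvPolynomial.induction_on with
  | C a => simpa using hasDerivAt_const t a
  | add p q hp hq => simpa only [map_add] using hp.fun_add hq
  | mul_X p i hp =>
    have hX : HasDerivAt (fun t => Function.update z j t i)
        (eval (Function.update z j t) (pderiv j (X i : MvPolynomial (Fin k) ℝ))) t := by
      by_cases h : i = j
      · subst h; simpa using hasDerivAt_id' t
      · simpa [h, pderiv_X_of_ne h] using hasDerivAt_const t (z i)
    have := hp.mul hX
    simp only [map_mul, eval_X, pderiv_mul, map_add]
    exact this

lemma eval_pderiv_eq_zero_of_isLocalMin {k : ℕ} {z : Fin k → ℝ} {p : MvPolynomial (Fin k) ℝ}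
    (h : IsLocalMin (fun x => eval x p) z) (j : Fin k) : eval z (pderiv j p) = 0 := by
  have h1 := hasDerivAt_eval_update j z p (z j)
  rw [Function.update_eq_self] at h1
  refine IsLocalMin.hasDerivAt_eq_zero ?_ h1
  have hc : ContinuousAt (fun t => Function.update z j t) (z j) := by fun_prop
  have h2 : ∀ᶠ x in nhds (Function.update z j (z j)), eval z p ≤ eval x p := by
    rw [Function.update_eq_self]
    exact h
  have := hc.eventually h2
  simpa [IsLocalMin, IsMinFilter] using this

/-- A compact real algebraic set `{Q = 0}` with `Q ≥ 0` of degree at most `2 e` has at most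
`(2 e + 1) ^ k` pairwise disjoint nonempty relatively clopen subsets. -/
lemma card_clopen_le {k e : ℕ} {ι : Type*} [Fintype ι] (Q : MvPolynomial (Fin k) ℝ)
    (hQ : Q.totalDegree ≤ 2 * e) (hQ0 : ∀ x, 0 ≤ eval x Q)
    (hb : Bornology.IsBounded {x | eval x Q = 0}) (K : ι → Set (Fin k → ℝ))
    (hne : ∀ i, (K i).Nonempty) (hK : ∀ i, K i ⊆ {x | eval x Q = 0})
    (hcl : ∀ i, IsClosed (K i)) (hop : ∀ i, IsClosed ({x | eval x Q = 0} \ K i))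
    (hd : ∀ i j, i ≠ j → Disjoint (K i) (K j)) : Fintype.card ι ≤ (2 * e + 1) ^ k := by
  classical
  set Z := {x | eval x Q = 0} with hZ
  have hQc : Continuous fun x => eval x Q := MvPolynomial.continuous_eval Q
  have hcomp : ∀ i, IsCompact (K i) := fun i =>
    Metric.isCompact_of_isClosed_isBounded (hcl i) (hb.subset (hK i))
  have h1 : ∀ i, ∃ δ : ℝ, 0 < δ ∧
      Disjoint (Metric.cthickening δ (K i)) (Metric.cthickening δ (Z \ K i)) := fun i =>
    disjoint_sdiff_right.exists_cthickenings (hcomp i) (hop i)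
  choose δ' hδ' hδd' using h1
  obtain ⟨δ, hδ, hδle⟩ := exists_pos_forall_le δ' hδ'
  have hδd : ∀ i, Disjoint (Metric.cthickening δ (K i)) (Metric.cthickening δ (Z \ K i)) :=
    fun i => (hδd' i).mono (Metric.cthickening_mono (hδle i) _) (Metric.cthickening_mono (hδle i) _)
  have hA : ∀ i, IsCompact (Metric.cthickening δ (K i)) := fun i => (hcomp i).cthickening
  let g : (Fin k → ℝ) → ℝ := fun x => ∑ j, x j ^ (2 * e + 2)
  have hg : ∀ x, 0 ≤ g x := fun x => Finset.sum_nonneg fun j _ =>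
    (show Even (2 * e + 2) by exact ⟨e + 1, by ring⟩).pow_nonneg _
  have h2 : ∀ i, ∃ μ : ℝ, 0 < μ ∧
      ∀ x ∈ Metric.cthickening δ (K i) \ Metric.thickening δ (K i), μ ≤ eval x Q := by
    intro i
    have hc : IsCompact (Metric.cthickening δ (K i) \ Metric.thickening δ (K i)) :=
      (hA i).diff Metric.isOpen_thickening
    refine hc.exists_forall_le' (a := 0) hQc.continuousOn ?_
    rintro x ⟨hx, hx'⟩
    refine lt_of_le_of_ne (hQ0 x) fun h => ?_
    by_cases hxK : x ∈ K i
    · exact hx' (Metric.self_subset_thickening hδ _ hxK)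
    · exact (Set.disjoint_left.1 (hδd i)) hx (Metric.self_subset_cthickening _ ⟨h.symm, hxK⟩)
  choose μ hμ hμle using h2
  choose p hp using hne
  obtain ⟨ε, hε, hεle⟩ := exists_pos_forall_le (fun i => μ i / (g (p i) + 1))
    (fun i => div_pos (hμ i) (by linarith [hg (p i)]))
  let R : MvPolynomial (Fin k) ℝ := Q + C ε * ∑ j, X j ^ (2 * e + 2)
  have hR : ∀ x, eval x R = eval x Q + ε * g x := fun x => by simp [R, g]
  have h3 : ∀ i, ∃ z ∈ Metric.thickening δ (K i), IsLocalMin (fun x => eval x R) z := by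
    intro i
    have hpA : p i ∈ Metric.cthickening δ (K i) := Metric.self_subset_cthickening _ (hp i)
    obtain ⟨z, hz, hmin⟩ := (hA i).exists_isMinOn ⟨_, hpA⟩
      (MvPolynomial.continuous_eval R).continuousOn
    have hzt : z ∈ Metric.thickening δ (K i) := by
      by_contra hcon
      have h4 := hμle i z ⟨hz, hcon⟩
      have h5 : eval z R ≤ eval (p i) R := hmin hpA
      rw [hR, hR, show eval (p i) Q = 0 from hK i (hp i)] at h5
      have h6 := mul_nonneg hε.le (hg z)
      have h7 := hεle i
      rw [le_div_iff₀ (by linarith [hg (p i)])] at h7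
      nlinarith
    exact ⟨z, hzt, hmin.isLocalMin (Filter.mem_of_superset
      (Metric.isOpen_thickening.mem_nhds hzt) (Metric.thickening_subset_cthickening _ _))⟩
  choose z hz hzmin using h3
  have hinj : Function.Injective z := by
    intro i j hij
    by_contra hne
    refine Set.disjoint_left.1 (hδd i) (Metric.thickening_subset_cthickening _ _ (hz i)) ?_
    rw [hij]
    refine Metric.cthickening_subset_of_subset δ ?_
      (Metric.thickening_subset_cthickening _ _ (hz j))
    exact fun x hx => ⟨hK j hx, fun h => Set.disjoint_left.1 (hd i j hne) h hx⟩
  have hcard := card_le_of_pow_eq (D := 2 * e + 1)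
    (fun j => C (-(1 / (ε * (2 * e + 2)))) * pderiv j Q)
    (fun j => by
      refine (totalDegree_mul _ _).trans_lt ?_
      rw [totalDegree_C]
      have := totalDegree_pderiv_le j Q
      omega)
    (Finset.univ.image z) (by
      intro v hv j
      obtain ⟨i, -, rfl⟩ := Finset.mem_image.1 hv
      have h8 := eval_pderiv_eq_zero_of_isLocalMin (hzmin i) j
      have h9 : eval (z i) (pderiv j R)
          = eval (z i) (pderiv j Q) + ε * ((2 * e + 2) * z i j ^ (2 * e + 1)) := by
        simp only [R, map_add, pderiv_C_mul, map_mul, map_sum, pderiv_pow, eval_C]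
        rw [Finset.sum_eq_single j]
        · simp
        · intro b _ hb
          simp [pderiv_X_of_ne hb]
        · simp
      rw [h9] at h8
      simp only [map_mul, eval_C]
      have : (0 : ℝ) < ε * (2 * e + 2) := by positivity
      field_simp
      linarith)
  rwa [Finset.card_image_of_injective _ hinj, Finset.card_univ] at hcard

/-- `S` is stable under weakening of the sign conditions of `Ps`. -/
def SignClosed {k : ℕ} (Ps : Finset (MvPolynomial (Fin k) ℝ)) (S : Set (Fin k → ℝ)) : Prop :=
  ∀ z ∈ S, ∀ w, (∀ P ∈ Ps, (eval z P = 0 → eval w P = 0) ∧ (0 < eval z P → 0 ≤ eval w P) ∧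
    (eval z P < 0 → eval w P ≤ 0)) → w ∈ S

/-- The members of `Ps` vanishing at `x`. -/
noncomputable def activeSet {k : ℕ} (Ps : Finset (MvPolynomial (Fin k) ℝ)) (x : Fin k → ℝ) :
    Finset (MvPolynomial (Fin k) ℝ) :=
  open scoped Classical in Ps.filter fun P => eval x P = 0

lemma mem_activeSet {k : ℕ} {Ps : Finset (MvPolynomial (Fin k) ℝ)} {x : Fin k → ℝ}
    {P : MvPolynomial (Fin k) ℝ} : P ∈ activeSet Ps x ↔ P ∈ Ps ∧ eval x P = 0 := by
  classical
  simp [activeSet]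

lemma activeSet_subset {k : ℕ} (Ps : Finset (MvPolynomial (Fin k) ℝ)) (x : Fin k → ℝ) :
    activeSet Ps x ⊆ Ps := fun _ hP => (mem_activeSet.1 hP).1

lemma card_activeSet_le {k : ℕ} {Ps : Finset (MvPolynomial (Fin k) ℝ)}
    (hgp : ∀ F : Finset (MvPolynomial (Fin k) ℝ), F ⊆ Ps → F.card = k + 1 →
      ∀ x : Fin k → ℝ, ∃ Q ∈ F, eval x Q ≠ 0) (x : Fin k → ℝ) :
    (activeSet Ps x).card ≤ k := by
  by_contra h
  obtain ⟨F, hF, hc⟩ := Finset.exists_subset_card_eq (show k + 1 ≤ (activeSet Ps x).card by omega)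
  obtain ⟨Q, hQ, hne⟩ := hgp F (hF.trans (activeSet_subset Ps x)) hc x
  exact hne (mem_activeSet.1 (hF hQ)).2

lemma SignClosed.eventually_mem {k : ℕ} {Ps : Finset (MvPolynomial (Fin k) ℝ)}
    {S : Set (Fin k → ℝ)} (hS : SignClosed Ps S) {z : Fin k → ℝ} (hz : z ∈ S) :
    ∀ᶠ w in nhds z, (∀ P ∈ activeSet Ps z, eval w P = 0) → w ∈ S := by
  have h : ∀ P ∈ Ps, ∀ᶠ w in nhds z, (0 < eval z P → 0 < eval w P) ∧
      (eval z P < 0 → eval w P < 0) := by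
    intro P _
    have hc := (MvPolynomial.continuous_eval P).tendsto z
    refine Filter.Eventually.and ?_ ?_
    · by_cases h : 0 < eval z P
      · exact (hc.eventually (lt_mem_nhds h)).mono fun w hw _ => hw
      · exact Filter.Eventually.of_forall fun w h' => absurd h' h
    · by_cases h : eval z P < 0
      · exact (hc.eventually (gt_mem_nhds h)).mono fun w hw _ => hw
      · exact Filter.Eventually.of_forall fun w h' => absurd h' h
  filter_upwards [(Filter.eventually_all_finset Ps).2 h] with w hw hact
  exact hS z hz w fun P hP => ⟨fun h0 => hact P (mem_activeSet.2 ⟨hP, h0⟩),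
    fun h => ((hw P hP).1 h).le, fun h => ((hw P hP).2 h).le⟩

lemma isBounded_of_subset_sphere {k : ℕ} {r : ℝ} {S : Set (Fin k → ℝ)}
    (hS : S ⊆ {x | ∑ i, x i ^ 2 = r ^ 2}) : Bornology.IsBounded S := by
  refine (Metric.isBounded_closedBall (x := (0 : Fin k → ℝ)) (r := |r|)).subset fun x hx => ?_
  rw [mem_closedBall_zero_iff, pi_norm_le_iff_of_nonneg (abs_nonneg r)]
  intro i
  have h1 : x i ^ 2 ≤ r ^ 2 := by
    rw [← show ∑ i, x i ^ 2 = r ^ 2 from hS hx]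
    exact Finset.single_le_sum (f := fun i => x i ^ 2) (fun i _ => sq_nonneg _) (Finset.mem_univ i)
  rw [Real.norm_eq_abs]
  exact sq_le_sq.1 h1

lemma card_powerset_filter_card_le {α : Type*} [DecidableEq α] (s : Finset α) (k : ℕ) :
    (s.powerset.filter fun F => F.card ≤ k).card ≤ (s.card + 1) ^ k := by
  have hsub : (s.powerset.filter fun F => F.card ≤ k) ⊆
      (Finset.univ : Finset (Fin k → Option s)).image
        (fun f => s.filter fun a => ∃ i, (f i).map Subtype.val = some a) := by
    intro F hF
    rw [Finset.mem_filter, Finset.mem_powerset] at hF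
    obtain ⟨g, hg⟩ : ∃ g : F → Fin k, Function.Injective g := by
      have : Fintype.card F ≤ Fintype.card (Fin k) := by simpa using hF.2
      exact (Function.Embedding.nonempty_of_card_le this).elim fun e => ⟨e, e.injective⟩
    refine Finset.mem_image.2 ⟨fun i => if h : ∃ a : F, g a = i then
      some ⟨h.choose.1, hF.1 h.choose.2⟩ else none, Finset.mem_univ _, ?_⟩
    ext a
    simp only [Finset.mem_filter]
    constructor
    · rintro ⟨-, i, hi⟩
      by_cases h : ∃ a : F, g a = i
      · simp only [h, dite_true, Option.map_some, Option.some.injEq] at hi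
        rw [← hi]
        exact h.choose.2
      · simp [h] at hi
    · intro ha
      refine ⟨hF.1 ha, g ⟨a, ha⟩, ?_⟩
      have h : ∃ b : F, g b = g ⟨a, ha⟩ := ⟨_, rfl⟩
      simp only [h, dite_true, Option.map_some, Option.some.injEq]
      rw [hg h.choose_spec]
  refine (Finset.card_le_card hsub).trans (Finset.card_image_le.trans ?_)
  simp

/-- A bounded set given by closed sign conditions in general position has at most singly
exponentially many pairwise disjoint nonempty relatively clopen subsets. -/
lemma card_clopen_le_of_signClosed {k d : ℕ} {ι : Type*} [Fintype ι]
    {Ps : Finset (MvPolynomial (Fin k) ℝ)} {S : Set (Fin k → ℝ)} {r : ℝ} (hd2 : 2 ≤ d)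
    (hdeg : ∀ P ∈ Ps, P.totalDegree ≤ d)
    (hgp : ∀ F : Finset (MvPolynomial (Fin k) ℝ), F ⊆ Ps → F.card = k + 1 →
      ∀ x : Fin k → ℝ, ∃ Q ∈ F, eval x Q ≠ 0)
    (hS : SignClosed Ps S) (hSr : S ⊆ {x | ∑ i, x i ^ 2 = r ^ 2})
    (K : ι → Set (Fin k → ℝ)) (hne : ∀ i, (K i).Nonempty) (hK : ∀ i, K i ⊆ S)
    (hcl : ∀ i, IsClosed (K i)) (hop : ∀ i, IsClosed (S \ K i))
    (hd : ∀ i j, i ≠ j → Disjoint (K i) (K j)) :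
    Fintype.card ι ≤ (2 * d + 1) ^ k * (Ps.card + 1) ^ k := by
  classical
  have hmax : ∀ i, ∃ x ∈ K i, ∀ z ∈ K i, (activeSet Ps z).card ≤ (activeSet Ps x).card := by
    intro i
    have hfin : ((fun z => (activeSet Ps z).card) '' K i).Finite :=
      (Set.finite_Iic k).subset (by rintro _ ⟨z, -, rfl⟩; exact card_activeSet_le hgp z)
    obtain ⟨_, ⟨x, hx, rfl⟩, hm⟩ := Set.exists_max_image _ id hfin ((hne i).image _)
    exact ⟨x, hx, fun z hz => hm _ ⟨z, hz, rfl⟩⟩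
  choose x hx hxmax using hmax
  let Q : Finset (MvPolynomial (Fin k) ℝ) → MvPolynomial (Fin k) ℝ := fun F =>
    ∑ P ∈ F, P ^ 2 + (∑ i, X i ^ 2 - C (r ^ 2)) ^ 2
  have hQev : ∀ F y, eval y (Q F) = ∑ P ∈ F, eval y P ^ 2 + (∑ i, y i ^ 2 - r ^ 2) ^ 2 :=
    fun F y => by simp [Q]
  have hQ0 : ∀ F y, 0 ≤ eval y (Q F) := fun F y => by
    rw [hQev]; positivity
  have hQz : ∀ F y, eval y (Q F) = 0 ↔ (∀ P ∈ F, eval y P = 0) ∧ ∑ i, y i ^ 2 = r ^ 2 := by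
    intro F y
    rw [hQev, add_eq_zero_iff_of_nonneg (by positivity) (by positivity),
      Finset.sum_eq_zero_iff_of_nonneg (fun _ _ => sq_nonneg _)]
    simp [sub_eq_zero]
  have hQdeg : ∀ F ⊆ Ps, (Q F).totalDegree ≤ 2 * d := by
    intro F hF
    refine (totalDegree_add _ _).trans (max_le ?_ ?_)
    · refine totalDegree_finsetSum_le fun P hP => (totalDegree_pow _ _).trans ?_
      have := hdeg P (hF hP)
      omega
    · refine (totalDegree_pow _ _).trans (Nat.mul_le_mul_left 2 ?_)
      refine (totalDegree_sub _ _).trans (max_le ?_ (by rw [totalDegree_C]; exact Nat.zero_le _))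
      refine totalDegree_finsetSum_le fun i _ => (totalDegree_pow _ _).trans ?_
      simp [hd2]
  have hfiber : ∀ F ∈ (Ps.powerset.filter fun F => F.card ≤ k),
      (Finset.univ.filter fun i => activeSet Ps (x i) = F).card ≤ (2 * d + 1) ^ k := by
    intro F hF
    rw [Finset.mem_filter, Finset.mem_powerset] at hF
    have := card_clopen_le (ι := {i // activeSet Ps (x i) = F}) (Q F) (hQdeg F hF.1) (hQ0 F)
      (isBounded_of_subset_sphere fun y hy => ((hQz F y).1 hy).2)
      (fun i => K i.1 ∩ {y | eval y (Q F) = 0}) ?_ (fun i => inter_subset_right) ?_ ?_ ?_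
    · rwa [Fintype.card_subtype] at this
    · rintro ⟨i, rfl⟩
      exact ⟨x i, hx i, (hQz _ _).2 ⟨fun P hP => (mem_activeSet.1 hP).2, hSr (hK i (hx i))⟩⟩
    · intro i
      exact (hcl i).inter (isClosed_eq (MvPolynomial.continuous_eval _) continuous_const)
    · rintro ⟨i, rfl⟩
      set F := activeSet Ps (x i)
      rw [isClosed_iff_frequently]
      intro z hz
      have hzW : eval z (Q F) = 0 :=
        (isClosed_eq (MvPolynomial.continuous_eval (Q F)) continuous_const).mem_of_frequently_of_tendsto
          (hz.mono fun y hy => hy.1) Filter.tendsto_id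
      refine ⟨hzW, fun hzK => ?_⟩
      have hzK : z ∈ K i := hzK.1
      have hact : activeSet Ps z = F := by
        refine (Finset.eq_of_subset_of_card_le (fun P hP => ?_) (hxmax i z hzK)).symm
        exact mem_activeSet.2 ⟨activeSet_subset _ _ hP, ((hQz F z).1 hzW).1 P hP⟩
      have h1 := hS.eventually_mem (hK i hzK)
      have h2 : ∀ᶠ w in nhds z, w ∉ S \ K i :=
        (hop i).isOpen_compl.mem_nhds fun h => h.2 hzK
      obtain ⟨w, hw, hw1, hw2⟩ := (hz.and_eventually (h1.and h2)).exists
      have hwS : w ∈ S := hw1 (by rw [hact]; exact ((hQz F w).1 hw.1).1)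
      exact hw.2 ⟨not_not.1 fun h => hw2 ⟨hwS, h⟩, hw.1⟩
    · intro i j hij
      exact (hd i.1 j.1 fun h => hij (Subtype.ext h)).mono inter_subset_left inter_subset_left
  have h1 := Finset.card_le_mul_card_image_of_maps_to (s := (Finset.univ : Finset ι))
    (t := Ps.powerset.filter fun F => F.card ≤ k) (f := fun i => activeSet Ps (x i))
    (fun i _ => Finset.mem_filter.2 ⟨Finset.mem_powerset.2 (activeSet_subset _ _),
      card_activeSet_le hgp _⟩) ((2 * d + 1) ^ k) hfiber
  rw [Finset.card_univ] at h1
  exact h1.trans (Nat.mul_le_mul_left _ (card_powerset_filter_card_le Ps k))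

lemma eval_affine_of_totalDegree_le_one {k : ℕ} {p : MvPolynomial (Fin k) ℝ}
    (hp : p.totalDegree ≤ 1) (x z : Fin k → ℝ) (τ : ℝ) :
    eval (fun i => (1 - τ) * x i + τ * z i) p = (1 - τ) * eval x p + τ * eval z p := by
  simp only [eval_eq', Finset.mul_sum, ← Finset.sum_add_distrib]
  refine Finset.sum_congr rfl fun m hm => ?_
  have h1 := (le_totalDegree hm).trans hp
  have h2 : m = 0 ∨ ∃ i, m = Finsupp.single i 1 := by
    rcases Nat.le_one_iff_eq_zero_or_eq_one.1 h1 with h | h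
    · left
      ext i
      by_contra hi
      have := Finset.single_le_sum (f := fun i => m i) (fun _ _ => Nat.zero_le _)
        (Finsupp.mem_support_iff.2 hi)
      have h' : ∑ i ∈ m.support, m i = 0 := h
      simp only [Finsupp.coe_zero, Pi.zero_apply] at hi
      omega
    · right
      exact (Finsupp.sum_eq_one_iff m).1 h
  rcases h2 with rfl | ⟨i, rfl⟩
  · simp; ring
  · have h3 : ∀ y : Fin k → ℝ, ∏ j, y j ^ ((Finsupp.single i 1 : Fin k →₀ ℕ) j) = y i := by
      intro y
      rw [Finset.prod_eq_single i] <;> simp +contextual [eq_comm]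
    simp only [h3]
    ring

/-- In degree one, a set of points on a sphere is finite and its points are vertices. -/
lemma card_le_of_totalDegree_le_one {k : ℕ} (hk : 1 ≤ k)
    {Ps : Finset (MvPolynomial (Fin k) ℝ)} {S : Set (Fin k → ℝ)} {r : ℝ}
    (hdeg : ∀ P ∈ Ps, P.totalDegree ≤ 1)
    (hgp : ∀ F : Finset (MvPolynomial (Fin k) ℝ), F ⊆ Ps → F.card = k + 1 →
      ∀ x : Fin k → ℝ, ∃ Q ∈ F, eval x Q ≠ 0)
    (hS : SignClosed Ps S) (hSr : S ⊆ {x | ∑ i, x i ^ 2 = r ^ 2}) :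
    S.Finite ∧ S.ncard ≤ Ps.card ^ k := by
  classical
  have huniq : ∀ x ∈ S, ∀ z, (∀ P ∈ activeSet Ps x, eval z P = 0) → z = x := by
    intro x hx z hz
    have hc : Filter.Tendsto (fun τ : ℝ => fun i => (1 - τ) * x i + τ * z i) (nhds 0) (nhds x) := by
      have : Continuous (fun τ : ℝ => fun i => (1 - τ) * x i + τ * z i) := by fun_prop
      simpa using this.tendsto 0
    have h1 : ∀ᶠ τ : ℝ in nhds 0, (fun i => (1 - τ) * x i + τ * z i) ∈ S := by
      filter_upwards [hc.eventually (hS.eventually_mem hx)] with τ hτ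
      refine hτ fun P hP => ?_
      rw [eval_affine_of_totalDegree_le_one (hdeg P (activeSet_subset _ _ hP)),
        (mem_activeSet.1 hP).2, hz P hP]
      ring
    obtain ⟨ε, hε, hball⟩ := Metric.eventually_nhds_iff.1 h1
    have hp := hSr (hball (y := ε / 2) (by rw [Real.dist_eq, sub_zero, abs_of_pos] <;> linarith))
    have hm := hSr (hball (y := -(ε / 2))
      (by rw [Real.dist_eq, sub_zero, abs_neg, abs_of_pos] <;> linarith))
    have h0 := hSr hx
    simp only [mem_ofPred_eq] at hp hm h0
    have hsum : ∑ i, (2 * (ε / 2) ^ 2 * (z i - x i) ^ 2) = 0 := by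
      have : ∑ i, (2 * (ε / 2) ^ 2 * (z i - x i) ^ 2) =
          ∑ i, ((1 - ε / 2) * x i + ε / 2 * z i) ^ 2 +
          ∑ i, ((1 - -(ε / 2)) * x i + -(ε / 2) * z i) ^ 2 - 2 * ∑ i, x i ^ 2 := by
        rw [Finset.mul_sum, ← Finset.sum_add_distrib, ← Finset.sum_sub_distrib]
        exact Finset.sum_congr rfl fun i _ => by ring
      rw [this, hp, hm, h0]; ring
    rw [Finset.sum_eq_zero_iff_of_nonneg (fun i _ => by positivity)] at hsum
    ext i
    have h2 := hsum i (Finset.mem_univ i)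
    have h3 : (2 * (ε / 2) ^ 2 : ℝ) ≠ 0 := by positivity
    have h4 := pow_eq_zero_iff (two_ne_zero) |>.1 ((mul_eq_zero.1 h2).resolve_left h3)
    linarith
  have hsur : ∀ x ∈ S, ∃ f : Fin k → Ps,
      (Finset.univ.image fun i => (f i : MvPolynomial (Fin k) ℝ)) = activeSet Ps x := by
    intro x hx
    have hnon : (activeSet Ps x).Nonempty := by
      rw [Finset.nonempty_iff_ne_empty]
      intro he
      have h1 := huniq x hx (fun i => x i + 1) (by simp [he])
      have h2 := congrFun h1 ⟨0, hk⟩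
      simp at h2
    have hcard : Fintype.card (activeSet Ps x) ≤ Fintype.card (Fin k) := by
      simpa using card_activeSet_le hgp x
    obtain ⟨e⟩ := Function.Embedding.nonempty_of_card_le hcard
    have : Nonempty (activeSet Ps x) := hnon.to_subtype
    have hsurj := Function.invFun_surjective e.injective
    refine ⟨fun i => ⟨(Function.invFun e i).1, activeSet_subset _ _ (Function.invFun e i).2⟩, ?_⟩
    ext P
    simp only [Finset.mem_image, Finset.mem_univ, true_and]
    constructor
    · rintro ⟨i, rfl⟩
      exact (Function.invFun e i).2
    · intro hP
      obtain ⟨i, hi⟩ := hsurj ⟨P, hP⟩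
      exact ⟨i, by rw [hi]⟩
  choose f hf using fun x : S => hsur x.1 x.2
  have hinj : Function.Injective f := by
    intro x y hxy
    have h1 : activeSet Ps x.1 = activeSet Ps y.1 := by rw [← hf x, ← hf y, hxy]
    exact Subtype.ext (huniq y.1 y.2 x.1 fun P hP => (mem_activeSet.1 (h1 ▸ hP)).2)
  have hfin : Finite S := Finite.of_injective f hinj
  refine ⟨Set.toFinite S, ?_⟩
  have := Nat.card_le_card_of_injective f hinj
  simpa [Nat.card_coe_set_eq] using this

lemma eq_empty_of_forall_eval_eq {k : ℕ}
    {Ps : Finset (MvPolynomial (Fin k) ℝ)} {S : Set (Fin k → ℝ)} {r : ℝ} (hr : 0 < r)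
    (hS : SignClosed Ps S) (hSr : S ⊆ {x | ∑ i, x i ^ 2 = r ^ 2})
    (hconst : ∀ P ∈ Ps, ∀ x, eval x P = eval 0 P) : S = ∅ := by
  rw [Set.eq_empty_iff_forall_notMem]
  intro x hx
  have h0 : (0 : Fin k → ℝ) ∈ S := hS x hx 0 fun P hP => by
    rw [hconst P hP x]
    exact ⟨id, le_of_lt, le_of_lt⟩
  have := hSr h0
  simp only [mem_ofPred_eq, Pi.zero_apply] at this
  have h2 : (0 : ℝ) < r ^ 2 := by positivity
  rw [← this] at h2
  simp at h2

/-- On an interval where `g` is injective, the point nearest to being a zero of `g`, described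
by conditions which are open in the data. -/
lemma exists_nearest_zero {a b : ℝ} (hab : a ≤ b) {g : ℝ → ℝ} (hg : ContinuousOn g (Icc a b))
    (hinj : InjOn g (Icc a b)) :
    ∃ s ∈ Icc a b, (∀ c, c < s ↔ c < b ∧ (c < a ∨ g (max a c) * (g b - g a) < 0)) ∧
      (∀ c, s < c ↔ a < c ∧ (b < c ∨ 0 < g (min b c) * (g b - g a))) ∧
      (∀ y ∈ Icc a b, g y = 0 → s = y) ∧ (s = a ∨ s = b ∨ g s = 0) := by
  rcases hab.eq_or_lt with rfl | hlt
  · refine ⟨a, ⟨le_rfl, le_rfl⟩, fun c => by simp, fun c => by simp, fun y hy _ => ?_, .inl rfl⟩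
    exact le_antisymm hy.1 hy.2
  wlog hmono : StrictMonoOn g (Icc a b) generalizing g
  · have hanti : StrictAntiOn g (Icc a b) :=
      (hg.strictMonoOn_of_injOn_Icc' hab hinj).resolve_left hmono
    obtain ⟨s, hs, h1, h2, h3, h4⟩ := this (g := fun y => - g y) hg.neg
      (fun x hx y hy h => hinj hx hy (neg_inj.1 h)) (fun x hx y hy h => neg_lt_neg (hanti hx hy h))
    refine ⟨s, hs, fun c => ?_, fun c => ?_, fun y hy h => h3 y hy (by simp [h]), ?_⟩
    · rw [h1, show ∀ u, -u * (-g b - -g a) = u * (g b - g a) from fun u => by ring]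
    · rw [h2, show ∀ u, -u * (-g b - -g a) = u * (g b - g a) from fun u => by ring]
    · simpa using h4
  have ha : a ∈ Icc a b := ⟨le_rfl, hab⟩
  have hb : b ∈ Icc a b := ⟨hab, le_rfl⟩
  have hpos : 0 < g b - g a := sub_pos.2 (hmono ha hb hlt)
  simp only [mul_neg_iff, mul_pos_iff, hpos, not_lt.2 hpos.le, and_true, and_false, or_false,
    false_or]
  obtain ⟨s, hs, hs1, hs2⟩ : ∃ s ∈ Icc a b, (s = a ∨ g s ≤ 0) ∧ (s = b ∨ 0 ≤ g s) := by
    rcases le_total 0 (g a) with h | h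
    · exact ⟨a, ha, .inl rfl, .inr h⟩
    rcases le_total (g b) 0 with h' | h'
    · exact ⟨b, hb, .inr h', .inl rfl⟩
    obtain ⟨s, hs, h0⟩ := intermediate_value_Icc hab hg ⟨h, h'⟩
    exact ⟨s, hs, .inr h0.le, .inr h0.ge⟩
  refine ⟨s, hs, fun c => ⟨fun hc => ⟨hc.trans_le hs.2, ?_⟩, ?_⟩,
    fun c => ⟨fun hc => ⟨hs.1.trans_lt hc, ?_⟩, ?_⟩, ?_, ?_⟩
  · by_cases hca : c < a
    · exact .inl hca
    have hca := not_lt.1 hca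
    right
    rw [max_eq_right hca]
    exact (hmono ⟨hca, (hc.trans_le hs.2).le⟩ hs hc).trans_le
      (hs1.resolve_left (hca.trans_lt hc).ne')
  · rintro ⟨h1, h2⟩
    by_contra hsc
    have hsc := not_lt.1 hsc
    rw [max_eq_right (hs.1.trans hsc)] at h2
    have h3 := h2.resolve_left (not_lt.2 (hs.1.trans hsc))
    have h4 := hs2.resolve_left (hsc.trans_lt h1).ne
    exact absurd h3 (not_lt.2 (h4.trans (hmono.monotoneOn hs ⟨hs.1.trans hsc, h1.le⟩ hsc)))
  · by_cases hca : b < c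
    · exact .inl hca
    have hca := not_lt.1 hca
    right
    rw [min_eq_right hca]
    exact (hs2.resolve_left (hc.trans_le hca).ne).trans_lt
      (hmono hs ⟨(hs.1.trans_lt hc).le, hca⟩ hc)
  · rintro ⟨h1, h2⟩
    by_contra hsc
    have hsc := not_lt.1 hsc
    rw [min_eq_right (hsc.trans hs.2)] at h2
    have h3 := h2.resolve_left (not_lt.2 (hsc.trans hs.2))
    have h4 := hs1.resolve_left (h1.trans_le hsc).ne'
    exact absurd h3 (not_lt.2 ((hmono.monotoneOn ⟨h1.le, hsc.trans hs.2⟩ hs hsc).trans h4))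
  · intro y hy h0
    rcases lt_trichotomy s y with h | h | h
    · have := hmono hs hy h
      rcases hs2 with rfl | h'
      · exact absurd h (not_lt.2 hy.2)
      · linarith
    · exact h
    · have := hmono hy hs h
      rcases hs1 with rfl | h'
      · exact absurd h (not_lt.2 hy.1)
      · linarith
  · rcases hs1 with h | h
    · exact .inl h
    rcases hs2 with h' | h'
    · exact .inr (.inl h')
    · exact .inr (.inr (le_antisymm h h'))

lemma exists_continuous_nearest_zero {X : Type*} [TopologicalSpace X] {a b : X → ℝ}
    (ha : Continuous a) (hb : Continuous b) (hab : ∀ x, a x ≤ b x) {g : X → ℝ → ℝ}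
    (hg : Continuous (Function.uncurry g)) (hinj : ∀ x, InjOn (g x) (Icc (a x) (b x))) :
    ∃ s : X → ℝ, Continuous s ∧ (∀ x, s x ∈ Icc (a x) (b x)) ∧
      (∀ x, ∀ y ∈ Icc (a x) (b x), g x y = 0 → s x = y) ∧
      (∀ x, s x = a x ∨ s x = b x ∨ g x (s x) = 0) := by
  have hgx : ∀ x, Continuous (g x) := fun x => hg.comp (by fun_prop : Continuous fun y => (x, y))
  choose s hs h1 h2 h3 h4 using fun x => exists_nearest_zero (hab x) (hgx x).continuousOn (hinj x)
  refine ⟨s, ?_, hs, h3, h4⟩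
  have hcomp : ∀ u : X → ℝ, Continuous u → Continuous fun x => g x (u x) := fun u hu =>
    hg.comp (continuous_id.prodMk hu)
  rw [OrderTopology.continuous_iff]
  intro c
  constructor
  · have : s ⁻¹' Ioi c = {x | c < b x} ∩ ({x | c < a x} ∪
        {x | g x (max (a x) c) * (g x (b x) - g x (a x)) < 0}) := by
      ext x; exact h1 x c
    rw [this]
    exact (isOpen_lt continuous_const hb).inter ((isOpen_lt continuous_const ha).union
      (isOpen_lt ((hcomp _ (ha.max continuous_const)).mul ((hcomp _ hb).sub (hcomp _ ha)))
        continuous_const))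
  · have : s ⁻¹' Iio c = {x | a x < c} ∩ ({x | b x < c} ∪
        {x | 0 < g x (min (b x) c) * (g x (b x) - g x (a x))}) := by
      ext x; exact h2 x c
    rw [this]
    exact (isOpen_lt ha continuous_const).inter ((isOpen_lt hb continuous_const).union
      (isOpen_lt continuous_const
        ((hcomp _ (hb.min continuous_const)).mul ((hcomp _ hb).sub (hcomp _ ha)))))

/-- Virtual roots: continuous functions, ordered, containing all the real roots of a
family of polynomials of constant degree, and whose values are roots of iterated derivatives. -/
lemma exists_virtual_roots {X : Type*} [TopologicalSpace X] {B : X → ℝ} (hB : Continuous B)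
    (hB0 : ∀ x, 0 ≤ B x) (D : ℕ) : ∀ p : X → Polynomial ℝ, (∀ x, p x ≠ 0) →
      (∀ x, (p x).natDegree = D) →
      (∀ j, Continuous fun z : X × ℝ => (Polynomial.derivative^[j] (p z.1)).eval z.2) →
      (∀ x y j, j < D → (Polynomial.derivative^[j] (p x)).eval y = 0 → |y| ≤ B x) →
      ∃ ρ : ℕ → X → ℝ, (∀ i, Continuous (ρ i)) ∧ (∀ i x, ρ i x ≤ ρ (i + 1) x) ∧
        (∀ x, ρ 0 x = - B x) ∧ (∀ i x, D < i → ρ i x = B x) ∧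
        (∀ i x, ρ i x = - B x ∨ ρ i x = B x ∨
          ∃ j < D, (Polynomial.derivative^[j] (p x)).eval (ρ i x) = 0) ∧
        (∀ x y, (p x).eval y = 0 → ∃ i, ρ i x = y) := by
  induction D with
  | zero =>
    intro p hp hd _ _
    refine ⟨fun i x => if i = 0 then - B x else B x, fun i => ?_, fun i x => ?_, fun x => by simp,
      fun i x hi => by simp [hi.ne'], fun i x => ?_, fun x y hy => ?_⟩
    · by_cases h : i = 0 <;> simp only [h, if_true, if_false]
      exacts [hB.neg, hB]
    · have := hB0 x
      rcases i with _ | i <;> simp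
      linarith
    · dsimp only
      split_ifs <;> simp
    · obtain ⟨c, hc⟩ := Polynomial.natDegree_eq_zero.1 (hd x)
      rw [← hc] at hy
      exact absurd (by rw [← hc, show c = 0 by simpa using hy, map_zero]) (hp x)
  | succ D ih =>
    intro p hp hd hcont hroot
    have hd' : ∀ x, (Polynomial.derivative (p x)).natDegree = D := fun x => by
      rw [Polynomial.natDegree_derivative, hd x, Nat.add_sub_cancel]
    have hp' : ∀ x, Polynomial.derivative (p x) ≠ 0 := fun x h => by
      have := Polynomial.derivative_eq_zero.1 h
      rw [hd x] at this
      omega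
    obtain ⟨ρ, h1, h2, h3, h4, h5, h6⟩ := ih (fun x => Polynomial.derivative (p x)) hp' hd'
      (fun j => by simpa only [← Function.iterate_succ_apply] using hcont (j + 1))
      (fun x y j hj h => hroot x y (j + 1) (by omega)
        (by rwa [Function.iterate_succ_apply]))
    have hmono : ∀ x, Monotone fun i => ρ i x := fun x => monotone_nat_of_le_succ fun i => h2 i x
    have hinj : ∀ i x, InjOn (fun y => (p x).eval y) (Icc (ρ i x) (ρ (i + 1) x)) := by
      intro i x y hy z hz hyz
      by_contra hne
      wlog hlt : y < z generalizing y z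
      · exact this hz hy hyz.symm (Ne.symm hne) (lt_of_le_of_ne (not_lt.1 hlt) (Ne.symm hne))
      obtain ⟨w, hw, hw0⟩ := exists_hasDerivAt_eq_zero hlt (p x).continuousOn hyz
        (fun w _ => (p x).hasDerivAt w)
      obtain ⟨j, hj⟩ := h6 x w hw0
      rcases Nat.lt_or_ge i j with h | h
      · have := hmono x (Nat.succ_le_of_lt h)
        simp only [hj] at this
        exact absurd (hw.2.trans_le hz.2) (not_lt.2 this)
      · have := hmono x h
        simp only [hj] at this
        exact absurd (hy.1.trans_lt hw.1) (not_lt.2 this)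
    choose s hs1 hs2 hs3 hs4 using fun i => exists_continuous_nearest_zero (h1 i) (h1 (i + 1))
      (h2 i) (g := fun x y => (p x).eval y) (hcont 0) (hinj i)
    have hold : ∀ i x, ρ i x = - B x ∨ ρ i x = B x ∨
        ∃ j < D + 1, (Polynomial.derivative^[j] (p x)).eval (ρ i x) = 0 := by
      intro i x
      rcases h5 i x with h | h | ⟨j, hj, h⟩
      · exact .inl h
      · exact .inr (.inl h)
      · exact .inr (.inr ⟨j + 1, by omega, by rwa [Function.iterate_succ_apply]⟩)
    refine ⟨fun i x => Nat.casesOn i (- B x) fun i => s i x, ?_, ?_, fun x => rfl, ?_, ?_, ?_⟩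
    · rintro (_ | i)
      exacts [hB.neg, hs1 i]
    · rintro (_ | i) x
      · exact (h3 x).symm.le.trans (hs2 0 x).1
      · exact (hs2 i x).2.trans (hs2 (i + 1) x).1
    · rintro (_ | i) x hi
      · omega
      · have := hs2 i x
        rw [h4 i x (by omega), h4 (i + 1) x (by omega)] at this
        exact le_antisymm this.2 this.1
    · rintro (_ | i) x
      · exact .inl rfl
      rcases hs4 i x with h | h | h
      · simpa only [h] using hold i x
      · simpa only [h] using hold (i + 1) x
      · exact .inr (.inr ⟨0, by omega, h⟩)
    · intro x y hy
      have hyB := abs_le.1 (hroot x y 0 (by omega) hy)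
      obtain ⟨i, hi1, hi2⟩ : ∃ i, ρ i x ≤ y ∧ y ≤ ρ (i + 1) x := by
        by_contra hno
        push Not at hno
        have : ∀ i, ρ i x ≤ y := by
          intro i
          induction i with
          | zero => rw [h3]; exact hyB.1
          | succ i ih => exact (hno i ih).le
        have h7 := hno (D + 1) (this _)
        rw [h4 _ x (by omega)] at h7
        linarith
      exact ⟨i + 1, hs3 i x y ⟨hi1, hi2⟩ hy⟩

/-- The `m`-th symmetric polynomial detecting the presence of `m` distinct values. -/
noncomputable def distinctPoly (E m : ℕ) : MvPolynomial (Fin E) ℝ :=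
  ∑ S ∈ Finset.powersetCard m Finset.univ, ∏ i ∈ S, ∏ j ∈ S, if i = j then 1 else X i - X j

lemma distinctPoly_isSymmetric (E m : ℕ) : (distinctPoly E m).IsSymmetric := by
  intro e
  rw [distinctPoly, map_sum]
  refine Finset.sum_bij' (fun S _ => S.map e.toEmbedding) (fun S _ => S.map e.symm.toEmbedding)
    ?_ ?_ ?_ ?_ ?_
  · intro S hS
    simpa [Finset.mem_powersetCard] using hS
  · intro S hS
    simpa [Finset.mem_powersetCard] using hS
  · intro S _
    ext; simp
  · intro S _
    ext; simp
  · intro S _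
    rw [Finset.prod_map, map_prod]
    refine Finset.prod_congr rfl fun i _ => ?_
    rw [Finset.prod_map, map_prod]
    refine Finset.prod_congr rfl fun j _ => ?_
    by_cases h : i = j <;> simp [h]

lemma aeval_distinctPoly_eq_zero {E m : ℕ} (α : Fin E → ℂ)
    (h : (Finset.univ.image α).card < m) : aeval α (distinctPoly E m) = 0 := by
  classical
  rw [distinctPoly, map_sum]
  refine Finset.sum_eq_zero fun S hS => ?_
  rw [Finset.mem_powersetCard] at hS
  obtain ⟨i, hi, j, hj, hij, hα⟩ := Finset.exists_ne_map_eq_of_card_lt_of_maps_to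
    (t := Finset.univ.image α) (f := α) (h.trans_eq hS.2.symm)
    (fun i _ => Finset.mem_image_of_mem _ (Finset.mem_univ i))
  rw [map_prod]
  refine Finset.prod_eq_zero hi ?_
  rw [map_prod]
  refine Finset.prod_eq_zero hj ?_
  simp [hij, hα]

lemma aeval_distinctPoly_ne_zero {E : ℕ} (α : Fin E → ℂ) :
    aeval α (distinctPoly E (Finset.univ.image α).card) ≠ 0 := by
  classical
  set A := Finset.univ.image α with hA
  set V : ℂ := ∏ a ∈ A, ∏ b ∈ A, if a = b then 1 else a - b with hV
  have hV0 : V ≠ 0 := by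
    refine Finset.prod_ne_zero_iff.2 fun a _ => Finset.prod_ne_zero_iff.2 fun b _ => ?_
    split_ifs with h
    · exact one_ne_zero
    · exact sub_ne_zero.2 h
  have hterm : ∀ S ∈ Finset.powersetCard A.card (Finset.univ : Finset (Fin E)),
      aeval α (∏ i ∈ S, ∏ j ∈ S, if i = j then 1 else (X i - X j : MvPolynomial (Fin E) ℝ)) =
        if S.image α = A then V else 0 := by
    intro S hS
    rw [Finset.mem_powersetCard] at hS
    split_ifs with h
    · have hinj : InjOn α S := Finset.card_image_iff.1 (by rw [h, hS.2])
      rw [map_prod, hV, ← h, Finset.prod_image hinj]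
      refine Finset.prod_congr rfl fun i hi => ?_
      rw [map_prod, Finset.prod_image hinj]
      refine Finset.prod_congr rfl fun j hj => ?_
      by_cases hij : i = j
      · simp [hij]
      · have : α i ≠ α j := fun h => hij (hinj hi hj h)
        simp [hij, this]
    · have hlt : (S.image α).card < S.card := by
        rw [hS.2]
        exact Finset.card_lt_card
          ((Finset.image_subset_image (Finset.subset_univ S)).ssubset_of_ne h)
      obtain ⟨i, hi, j, hj, hij, hα⟩ := Finset.exists_ne_map_eq_of_card_lt_of_maps_to
        (t := S.image α) (f := α) hlt (fun i hi => Finset.mem_image_of_mem _ hi)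
      rw [map_prod]
      refine Finset.prod_eq_zero hi ?_
      rw [map_prod]
      refine Finset.prod_eq_zero hj ?_
      simp [hij, hα]
  rw [distinctPoly, map_sum, Finset.sum_congr rfl hterm, ← Finset.sum_filter, Finset.sum_const,
    nsmul_eq_mul]
  refine mul_ne_zero (Nat.cast_ne_zero.2 (Finset.card_ne_zero.2 ?_)) hV0
  obtain ⟨S, -, hS, hinj⟩ := Finset.exists_subset_injOn_image_eq_of_surjOn (Finset.univ : Finset (Fin E)) A
    (f := α) (by rw [hA, Finset.coe_image]; exact surjOn_image α _)
  refine ⟨S, Finset.mem_filter.2 ⟨Finset.mem_powersetCard.2 ⟨Finset.subset_univ _, ?_⟩, hinj⟩⟩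
  rw [← hinj, Finset.card_image_of_injOn hS]

/-- The polynomial obtained by specializing the parameters, over the complex numbers. -/
noncomputable def cspec {n : ℕ} (P : Polynomial (MvPolynomial (Fin n) ℝ)) (x : Fin n → ℝ) :
    Polynomial ℂ := P.map ((algebraMap ℝ ℂ).comp (eval x))

section cspec
variable {n : ℕ} {P : Polynomial (MvPolynomial (Fin n) ℝ)} {c : ℝ}

lemma cspec_leadingCoeff (hc : c ≠ 0) (hP : P.leadingCoeff = C c) (x : Fin n → ℝ) :
    (cspec P x).leadingCoeff = c := by
  rw [cspec, Polynomial.leadingCoeff_map_of_leadingCoeff_ne_zero] <;> simp [hP, hc]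

lemma cspec_natDegree (hc : c ≠ 0) (hP : P.leadingCoeff = C c) (x : Fin n → ℝ) :
    (cspec P x).natDegree = P.natDegree :=
  Polynomial.natDegree_map_of_leadingCoeff_ne_zero _ (by simp [hP, hc])

lemma cspec_ne_zero (hc : c ≠ 0) (hP : P.leadingCoeff = C c) (x : Fin n → ℝ) :
    cspec P x ≠ 0 := fun h => by
  have := cspec_leadingCoeff hc hP x
  simp only [h, Polynomial.leadingCoeff_zero] at this
  exact hc (by exact_mod_cast this.symm)

lemma exists_fin_roots (hc : c ≠ 0) (hP : P.leadingCoeff = C c) (x : Fin n → ℝ) :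
    ∃ α : Fin P.natDegree → ℂ, Finset.univ.val.map α = (cspec P x).roots := by
  have h := Polynomial.splits_iff_card_roots.1 (IsAlgClosed.splits (cspec P x))
  rw [cspec_natDegree hc hP x] at h
  rw [← h, ← Multiset.coe_toList (cspec P x).roots, Multiset.coe_card]
  refine ⟨fun i => (cspec P x).roots.toList.get i, ?_⟩
  rw [Fin.univ_val_map, List.ofFn_get]

/-- The number of distinct complex roots depends only on the zero pattern of
finitely many polynomials in the parameters. -/
lemma exists_finset_card_roots (hc : c ≠ 0) (hP : P.leadingCoeff = C c) :
    ∃ G : Finset (MvPolynomial (Fin n) ℝ), ∀ x x' : Fin n → ℝ,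
      (∀ g ∈ G, eval x g = 0 ↔ eval x' g = 0) →
      (cspec P x).roots.toFinset.card = (cspec P x').roots.toFinset.card := by
  classical
  set E := P.natDegree with hE
  choose ψ hψ using fun m => esymmAlgHom_surjective (σ := Fin E) (n := E) ℝ (by simp)
    ⟨distinctPoly E m, distinctPoly_isSymmetric E m⟩
  let G : ℕ → MvPolynomial (Fin n) ℝ := fun m => aeval
    (fun i : Fin E => C ((-1) ^ (i + 1 : ℕ) / c) * P.coeff (E - (i + 1))) (ψ m)
  have hG : ∀ x, ∀ α : Fin E → ℂ, Finset.univ.val.map α = (cspec P x).roots → ∀ m,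
      ((eval x (G m) : ℝ) : ℂ) = aeval α (distinctPoly E m) := by
    intro x α hα m
    have h1 : distinctPoly E m = aeval (fun i : Fin E => esymm (Fin E) ℝ (i + 1)) (ψ m) := by
      rw [← esymmAlgHom_apply, hψ]
    have h2 : ∀ i : Fin E, aeval α (esymm (Fin E) ℝ (i + 1)) =
        algebraMap ℝ ℂ (eval x (C ((-1) ^ (i + 1 : ℕ) / c) * P.coeff (E - (i + 1)))) := by
      intro i
      have h3 : (cspec P x).natDegree = E := cspec_natDegree hc hP x
      have h4 := Polynomial.coeff_eq_esymm_roots_of_splits (IsAlgClosed.splits (cspec P x))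
        (k := E - (i + 1)) (by omega)
      rw [cspec_leadingCoeff hc hP, h3, show E - (E - (i + 1 : ℕ)) = i + 1 by omega, cspec,
        Polynomial.coeff_map, ← cspec] at h4
      rw [aeval_esymm_eq_multiset_esymm, hα, map_mul, map_mul, ← RingHom.comp_apply (algebraMap ℝ ℂ)
        _ (P.coeff _), h4]
      have hc' : (c : ℂ) ≠ 0 := by exact_mod_cast hc
      have hs : ((-1 : ℂ) ^ (i + 1 : ℕ)) * (-1) ^ (i + 1 : ℕ) = 1 := by
        rw [← mul_pow]; simp
      simp only [eval_C, map_div₀, map_pow, map_neg, map_one, Complex.coe_algebraMap]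
      field_simp
      linear_combination (-(cspec P x).roots.esymm (i + 1)) * hs
    rw [h1]
    change (algebraMap ℝ ℂ) (eval x (G m)) = _
    have h5 : (aeval α).comp (aeval fun i : Fin E => esymm (Fin E) ℝ (i + 1)) =
        (((Algebra.ofId ℝ ℂ).comp (aeval x : MvPolynomial (Fin n) ℝ →ₐ[ℝ] ℝ)).comp (aeval
    (fun i : Fin E => C ((-1) ^ (i + 1 : ℕ) / c) * P.coeff (E - (i + 1))))) := by
      refine MvPolynomial.algHom_ext fun i => ?_
      simp only [AlgHom.comp_apply, aeval_X, h2]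
      rfl
    exact (DFunLike.congr_fun h5 (ψ m)).symm
  refine ⟨(Finset.range (E + 1)).image G, ?_⟩
  suffices H : ∀ x x' : Fin n → ℝ, (∀ m ≤ E, eval x (G m) = 0 ↔ eval x' (G m) = 0) →
      (cspec P x).roots.toFinset.card ≤ (cspec P x').roots.toFinset.card by
    intro x x' h
    have h' : ∀ m ≤ E, eval x (G m) = 0 ↔ eval x' (G m) = 0 := fun m hm => h _
      (Finset.mem_image_of_mem _ (Finset.mem_range.2 (Nat.lt_succ_of_le hm)))
    exact le_antisymm (H x x' h') (H x' x fun m hm => (h' m hm).symm)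
  intro x x' h
  obtain ⟨α, hα⟩ := exists_fin_roots hc hP x
  obtain ⟨α', hα'⟩ := exists_fin_roots hc hP x'
  have himg : ∀ (β : Fin E → ℂ) y, Finset.univ.val.map β = (cspec P y).roots →
      (cspec P y).roots.toFinset = Finset.univ.image β := fun β y hβ => by
    rw [← hβ]; rfl
  rw [himg α x hα, himg α' x' hα']
  by_contra hlt
  have h1 := aeval_distinctPoly_eq_zero α' (not_le.1 hlt)
  rw [← hG x' α' hα'] at h1
  have h2 := aeval_distinctPoly_ne_zero α
  rw [← hG x α hα] at h2
  refine h2 ?_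
  have hle : (Finset.univ.image α).card ≤ E := Finset.card_image_le.trans (by simp [hE])
  exact_mod_cast (h _ hle).2 (by exact_mod_cast h1)

lemma continuous_cspec_eval (P : Polynomial (MvPolynomial (Fin n) ℝ)) (z : ℂ) :
    Continuous fun x : Fin n → ℝ => (cspec P x).eval z := by
  simp only [cspec, Polynomial.eval_map, Polynomial.eval₂_eq_sum_range]
  refine continuous_finsetSum _ fun i _ => Continuous.mul ?_ continuous_const
  exact Complex.continuous_ofReal.comp (MvPolynomial.continuous_eval _)

lemma eventually_exists_root (hc : c ≠ 0) (hP : P.leadingCoeff = C c) {x₀ : Fin n → ℝ} {z : ℂ}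
    (hz : (cspec P x₀).eval z = 0) {ε : ℝ} (hε : 0 < ε) :
    ∀ᶠ x in nhds x₀, ∃ w, (cspec P x).eval w = 0 ∧ ‖w - z‖ < ε := by
  have hc' : 0 < |c| := abs_pos.2 hc
  have h1 : ∀ᶠ x in nhds x₀, ‖(cspec P x).eval z‖ < |c| * ε ^ P.natDegree := by
    refine (((continuous_cspec_eval P z).norm).tendsto x₀).eventually (gt_mem_nhds ?_)
    rw [hz, norm_zero]
    positivity
  filter_upwards [h1] with x hx
  by_contra hno
  push Not at hno
  refine absurd hx (not_lt.2 ?_)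
  obtain ⟨α, hα⟩ := exists_fin_roots hc hP x
  have h2 := Polynomial.C_leadingCoeff_mul_prod_multiset_X_sub_C
    (Polynomial.splits_iff_card_roots.1 (IsAlgClosed.splits (cspec P x)))
  rw [← hα, cspec_leadingCoeff hc hP, Multiset.map_map] at h2
  have h3 : (cspec P x).eval z = c * ∏ i, (z - α i) := by
    rw [← h2, Polynomial.eval_mul, Polynomial.eval_C, ← Finset.prod_eq_multiset_prod,
      Polynomial.eval_prod]
    simp
  rw [h3, norm_mul, norm_prod, Complex.norm_real, Real.norm_eq_abs]
  refine mul_le_mul_of_nonneg_left ?_ hc'.le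
  have h4 : ∀ i ∈ (Finset.univ : Finset (Fin P.natDegree)), ε ≤ ‖z - α i‖ := by
    intro i _
    rw [norm_sub_rev]
    refine hno (α i) ?_
    have : α i ∈ (cspec P x).roots := by
      rw [← hα]
      exact Multiset.mem_map_of_mem _ (Finset.mem_univ i)
    exact (Polynomial.mem_roots'.1 this).2
  simpa using Finset.prod_le_prod (s := Finset.univ) (fun _ _ => hε.le) h4

/-- If the number of distinct complex roots is locally constant then distinct roots do not
merge. -/
lemma eventually_unique_root (hc : c ≠ 0) (hP : P.leadingCoeff = C c) (x₀ : Fin n → ℝ) {z : ℂ}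
    (hz : (cspec P x₀).eval z = 0) :
    ∃ ε > 0, ∀ᶠ x in nhds x₀,
      (cspec P x).roots.toFinset.card = (cspec P x₀).roots.toFinset.card →
      ∀ w w', (cspec P x).eval w = 0 → (cspec P x).eval w' = 0 → ‖w - z‖ < ε → ‖w' - z‖ < ε →
        w = w' := by
  classical
  have hmem : ∀ x w, w ∈ (cspec P x).roots.toFinset ↔ (cspec P x).eval w = 0 := fun x w => by
    rw [Multiset.mem_toFinset, Polynomial.mem_roots (cspec_ne_zero hc hP x), Polynomial.IsRoot]
  set A := (cspec P x₀).roots.toFinset with hA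
  obtain ⟨ε, hε, hsep⟩ := exists_pos_forall_le (ι := {q : A × A // q.1 ≠ q.2})
    (fun q => ‖(q.1.1.1 - q.1.2.1 : ℂ)‖ / 2) (fun q => by
      have : (q.1.1.1 - q.1.2.1 : ℂ) ≠ 0 := sub_ne_zero.2 fun h => q.2 (Subtype.ext h)
      positivity)
  have hsep' : ∀ a ∈ A, ∀ b ∈ A, ‖a - b‖ < 2 * ε → a = b := by
    intro a ha b hb hab
    by_contra hne
    have := hsep ⟨(⟨a, ha⟩, ⟨b, hb⟩), fun h => hne (congrArg Subtype.val h)⟩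
    simp only at this
    linarith
  refine ⟨ε, hε, ?_⟩
  have h1 : ∀ᶠ x in nhds x₀, ∀ a ∈ A, ∃ w, (cspec P x).eval w = 0 ∧ ‖w - a‖ < ε :=
    (Filter.eventually_all_finset A).2 fun a ha =>
      eventually_exists_root hc hP ((hmem x₀ a).1 ha) hε
  filter_upwards [h1] with x hx hcard w w' hw hw' hwz hwz'
  choose! f hf1 hf2 using hx
  have hinj : InjOn f A := by
    intro a ha b hb hab
    refine hsep' a ha b hb ?_
    have h2 := hf2 b hb
    rw [← hab] at h2
    calc ‖a - b‖ = ‖(f a - b) - (f a - a)‖ := by congr 1; ring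
      _ ≤ ‖f a - b‖ + ‖f a - a‖ := norm_sub_le _ _
      _ < 2 * ε := by linarith [hf2 a ha]
  have himg : A.image f = (cspec P x).roots.toFinset := by
    refine Finset.eq_of_subset_of_card_le ?_ ?_
    · intro w hw
      obtain ⟨a, ha, rfl⟩ := Finset.mem_image.1 hw
      exact (hmem x _).2 (hf1 a ha)
    · rw [Finset.card_image_of_injOn hinj, hcard]
  have key : ∀ w, (cspec P x).eval w = 0 → ‖w - z‖ < ε → w = f z := by
    intro w hw hwz
    rw [← hmem, ← himg, Finset.mem_image] at hw
    obtain ⟨a, ha, rfl⟩ := hw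
    congr 1
    refine hsep' a ha z ((hmem x₀ z).2 hz) ?_
    calc ‖a - z‖ = ‖(f a - z) - (f a - a)‖ := by congr 1; ring
      _ ≤ ‖f a - z‖ + ‖f a - a‖ := norm_sub_le _ _
      _ < 2 * ε := by linarith [hf2 a ha]
  rw [key w hw hwz, key w' hw' hwz']

/-- Along a connected family with a constant number of distinct complex roots, two root
functions agree everywhere or nowhere. -/
lemma eq_of_eq_of_card_roots {Y : Type*} [TopologicalSpace Y] [PreconnectedSpace Y]
    (hc : c ≠ 0) (hP : P.leadingCoeff = C c) {x : Y → Fin n → ℝ} (hx : Continuous x)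
    (hcard : ∀ y y', (cspec P (x y)).roots.toFinset.card = (cspec P (x y')).roots.toFinset.card)
    {u v : Y → ℝ} (hu : Continuous u) (hv : Continuous v)
    (hu0 : ∀ y, (cspec P (x y)).eval (u y : ℂ) = 0) (hv0 : ∀ y, (cspec P (x y)).eval (v y : ℂ) = 0)
    {y₀ : Y} (h : u y₀ = v y₀) (y : Y) : u y = v y := by
  have hclopen : IsClopen {y | u y = v y} := by
    refine ⟨isClosed_eq hu hv, isOpen_iff_mem_nhds.2 fun y₁ (hy₁ : u y₁ = v y₁) => ?_⟩
    obtain ⟨ε, hε, hev⟩ := eventually_unique_root hc hP (x y₁) (hu0 y₁)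
    have hnear : ∀ w : Y → ℝ, Continuous w → w y₁ = u y₁ →
        ∀ᶠ y in nhds y₁, ‖(w y : ℂ) - u y₁‖ < ε := by
      intro w hw he
      have h1 : Continuous fun y => ‖(w y : ℂ) - u y₁‖ := by fun_prop
      refine (h1.tendsto y₁).eventually (gt_mem_nhds ?_)
      simpa [he] using hε
    filter_upwards [hx.continuousAt.eventually hev, hnear u hu rfl, hnear v hv hy₁.symm]
      with y hy h1 h2
    exact_mod_cast hy (hcard _ _) _ _ (hu0 y) (hv0 y) h1 h2
  have := hclopen.eq_univ ⟨y₀, h⟩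
  exact (Set.ext_iff.1 this y).2 (mem_univ y)

/-- Along a connected family with a constant number of distinct complex roots, a factor
vanishes identically or nowhere on a root function. -/
lemma eval_eq_zero_of_card_roots {Y : Type*} [TopologicalSpace Y] [PreconnectedSpace Y]
    (hc : c ≠ 0) (hP : P.leadingCoeff = C c) {x : Y → Fin n → ℝ} (hx : Continuous x)
    (hcard : ∀ y y', (cspec P (x y)).roots.toFinset.card = (cspec P (x y')).roots.toFinset.card)
    {u : Y → ℝ} (hu : Continuous u) (hu0 : ∀ y, (cspec P (x y)).eval (u y : ℂ) = 0)
    {f : Polynomial (MvPolynomial (Fin n) ℝ)} {c' : ℝ} (hc' : c' ≠ 0)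
    (hf : f.leadingCoeff = C c') (hfP : f ∣ P)
    (hcont : Continuous fun y => (cspec f (x y)).eval (u y : ℂ))
    {y₀ : Y} (h : (cspec f (x y₀)).eval (u y₀ : ℂ) = 0) (y : Y) :
    (cspec f (x y)).eval (u y : ℂ) = 0 := by
  have hclopen : IsClopen {y | (cspec f (x y)).eval (u y : ℂ) = 0} := by
    refine ⟨isClosed_eq hcont continuous_const, isOpen_iff_mem_nhds.2 fun y₁ hy₁ => ?_⟩
    obtain ⟨ε, hε, hev⟩ := eventually_unique_root hc hP (x y₁) (hu0 y₁)
    have h1 : Continuous fun y => ‖(u y : ℂ) - u y₁‖ := by fun_prop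
    have h2 : ∀ᶠ y in nhds y₁, ‖(u y : ℂ) - u y₁‖ < ε :=
      (h1.tendsto y₁).eventually (gt_mem_nhds (by simpa using hε))
    filter_upwards [hx.continuousAt.eventually hev, h2,
      hx.continuousAt.eventually (eventually_exists_root hc' hf hy₁ hε)] with y hy h3 ⟨w, hw, hwz⟩
    have hw' : (cspec P (x y)).eval w = 0 := by
      obtain ⟨g, rfl⟩ := hfP
      rw [cspec, Polynomial.map_mul, Polynomial.eval_mul, ← cspec, hw, zero_mul]
    have := hy (hcard _ _) _ _ (hu0 y) hw' h3 hwz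
    change (cspec f (x y)).eval (u y : ℂ) = 0
    rw [this, hw]
  have := hclopen.eq_univ ⟨y₀, h⟩
  exact (Set.ext_iff.1 this y).2 (mem_univ y)

end cspec

/-- The leading coefficient is a nonzero real constant. -/
def ConstLead {n : ℕ} (P : Polynomial (MvPolynomial (Fin n) ℝ)) : Prop :=
  ∃ c : ℝ, c ≠ 0 ∧ P.leadingCoeff = C c

section ConstLead
variable {n : ℕ}

lemma ConstLead.mul {P Q : Polynomial (MvPolynomial (Fin n) ℝ)} (hP : ConstLead P)
    (hQ : ConstLead Q) : ConstLead (P * Q) := by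
  obtain ⟨c, hc, h⟩ := hP
  obtain ⟨c', hc', h'⟩ := hQ
  exact ⟨c * c', mul_ne_zero hc hc', by rw [Polynomial.leadingCoeff_mul, h, h', C_mul]⟩

lemma ConstLead.prod {ι : Type*} {s : Finset ι} {P : ι → Polynomial (MvPolynomial (Fin n) ℝ)}
    (hP : ∀ i ∈ s, ConstLead (P i)) : ConstLead (∏ i ∈ s, P i) := by
  classical
  induction s using Finset.induction_on with
  | empty => exact ⟨1, one_ne_zero, by simp⟩
  | insert i s hi ih =>
    rw [Finset.prod_insert hi]
    exact (hP i (Finset.mem_insert_self i s)).mul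
      (ih fun j hj => hP j (Finset.mem_insert_of_mem hj))

lemma ConstLead.iterate_derivative {P : Polynomial (MvPolynomial (Fin n) ℝ)} (hP : ConstLead P)
    {j : ℕ} (hj : j ≤ P.natDegree) : ConstLead (Polynomial.derivative^[j] P) ∧
      (Polynomial.derivative^[j] P).natDegree = P.natDegree - j := by
  induction j with
  | zero => exact ⟨hP, rfl⟩
  | succ j ih =>
    obtain ⟨⟨c, hc, h⟩, h2⟩ := ih (by omega)
    rw [Function.iterate_succ_apply']
    refine ⟨⟨c * (P.natDegree - j : ℕ), mul_ne_zero hc (Nat.cast_ne_zero.2 (by omega)), ?_⟩, ?_⟩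
    · rw [Polynomial.leadingCoeff_derivative, h, h2, C_mul]
      simp
    · rw [Polynomial.natDegree_derivative, h2]
      omega

lemma ConstLead.natDegree_map {P : Polynomial (MvPolynomial (Fin n) ℝ)} (hP : ConstLead P)
    (x : Fin n → ℝ) : (P.map (eval x)).natDegree = P.natDegree := by
  obtain ⟨c, hc, h⟩ := hP
  exact Polynomial.natDegree_map_of_leadingCoeff_ne_zero _ (by simp [h, hc])

lemma ConstLead.leadingCoeff_map {P : Polynomial (MvPolynomial (Fin n) ℝ)} (hP : ConstLead P)
    (x : Fin n → ℝ) : (P.map (eval x)).leadingCoeff = eval x P.leadingCoeff := by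
  obtain ⟨c, hc, h⟩ := hP
  exact Polynomial.leadingCoeff_map_of_leadingCoeff_ne_zero _ (by simp [h, hc])

lemma ConstLead.map_ne_zero {P : Polynomial (MvPolynomial (Fin n) ℝ)} (hP : ConstLead P)
    (x : Fin n → ℝ) : P.map (eval x) ≠ 0 := by
  have h1 := hP.leadingCoeff_map x
  obtain ⟨c, hc, h⟩ := hP
  intro h0
  rw [h0, h] at h1
  simp at h1
  exact hc h1.symm

lemma continuous_eval_map (P : Polynomial (MvPolynomial (Fin n) ℝ)) :
    Continuous fun z : (Fin n → ℝ) × ℝ => (P.map (eval z.1)).eval z.2 := by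
  simp only [Polynomial.eval_map, Polynomial.eval₂_eq_sum_range]
  refine continuous_finsetSum _ fun i _ => Continuous.mul ?_ (continuous_snd.pow i)
  exact (MvPolynomial.continuous_eval _).comp continuous_fst

lemma cspec_eval_ofReal (P : Polynomial (MvPolynomial (Fin n) ℝ)) (x : Fin n → ℝ) (y : ℝ) :
    (cspec P x).eval (y : ℂ) = ((P.map (eval x)).eval y : ℝ) := by
  rw [cspec, ← Polynomial.map_map, ← Complex.coe_algebraMap, Polynomial.eval_map_algebraMap,
    Polynomial.aeval_algebraMap_apply]
  simp

lemma cspec_eval_eq_zero (P : Polynomial (MvPolynomial (Fin n) ℝ)) (x : Fin n → ℝ) (y : ℝ) :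
    (cspec P x).eval (y : ℂ) = 0 ↔ (P.map (eval x)).eval y = 0 := by
  rw [cspec_eval_ofReal]
  exact_mod_cast Iff.rfl

lemma ConstLead.exists_root_bound {P : Polynomial (MvPolynomial (Fin n) ℝ)} (hP : ConstLead P) :
    ∃ B : MvPolynomial (Fin n) ℝ, ∀ x, 0 ≤ eval x B ∧
      ∀ y, (P.map (eval x)).eval y = 0 → |y| ≤ eval x B := by
  have hlead := hP.leadingCoeff_map
  have hdeg := hP.natDegree_map
  have hne := hP.map_ne_zero
  obtain ⟨c, hc, h⟩ := hP
  have hcoef : ∀ x, eval x (1 + ∑ i ∈ Finset.range P.natDegree,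
      C (|c|⁻¹) * (1 + P.coeff i ^ 2)) = 1 + ∑ i ∈ Finset.range P.natDegree,
      |c|⁻¹ * (1 + eval x (P.coeff i) ^ 2) := fun x => by simp
  have hnn : ∀ x i, 0 ≤ |c|⁻¹ * (1 + eval x (P.coeff i) ^ 2) := fun x i => by positivity
  refine ⟨1 + ∑ i ∈ Finset.range P.natDegree, C (|c|⁻¹) * (1 + P.coeff i ^ 2), fun x => ?_⟩
  rw [hcoef]
  refine ⟨add_nonneg zero_le_one (Finset.sum_nonneg fun i _ => hnn x i), fun y hy => ?_⟩
  have h1 := (Polynomial.IsRoot.norm_lt_cauchyBound (hne x) hy).le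
  rw [← NNReal.coe_le_coe, coe_nnnorm, Real.norm_eq_abs] at h1
  refine h1.trans ?_
  rw [Polynomial.cauchyBound, hdeg, hlead, h, eval_C, NNReal.coe_add, NNReal.coe_one, add_comm,
    NNReal.coe_div]
  refine add_le_add le_rfl ?_
  rw [div_eq_inv_mul, ← Finset.mul_sum, coe_nnnorm, Real.norm_eq_abs]
  refine mul_le_mul_of_nonneg_left ?_ (by positivity)
  rw [← Real.coe_toNNReal (∑ i ∈ Finset.range P.natDegree, (1 + eval x (P.coeff i) ^ 2))
    (by positivity), NNReal.coe_le_coe]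
  refine Finset.sup_le fun i hi => ?_
  rw [← NNReal.coe_le_coe, Real.coe_toNNReal _ (by positivity), coe_nnnorm, Polynomial.coeff_map,
    Real.norm_eq_abs]
  refine le_trans ?_ (Finset.single_le_sum (f := fun i => 1 + eval x (P.coeff i) ^ 2)
    (fun i _ => by positivity) hi)
  change |eval x (P.coeff i)| ≤ _
  rw [← sq_abs]
  nlinarith [abs_nonneg (eval x (P.coeff i)), sq_nonneg (|eval x (P.coeff i)| - 1)]

/-- Continuous root functions of a finite family of polynomials with constant leading
coefficients, whose coincidence pattern is controlled by finitely many polynomials in the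
parameters. -/
lemma exists_root_functions (Fs : Finset (Polynomial (MvPolynomial (Fin n) ℝ)))
    (hF : ∀ f ∈ Fs, ConstLead f) :
    ∃ (G : Finset (MvPolynomial (Fin n) ℝ)) (M : ℕ) (ρ : ℕ → (Fin n → ℝ) → ℝ),
      (∀ i, Continuous (ρ i)) ∧ (∀ i x, ρ i x ≤ ρ (i + 1) x) ∧ (∀ i x, M ≤ i → ρ i x = ρ M x) ∧
      (∀ f ∈ Fs, ∀ x y, (f.map (eval x)).eval y = 0 → ∃ i, ρ i x = y) ∧
      ∀ γ : ℝ → Fin n → ℝ, ContinuousOn γ (Icc 0 1) →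
        (∀ g ∈ G, ∀ t ∈ Ico (0 : ℝ) 1, eval (γ t) g = 0 ↔ eval (γ 0) g = 0) →
        ∀ t ∈ Ico (0 : ℝ) 1,
          (∀ i j, ρ i (γ t) = ρ j (γ t) ↔ ρ i (γ 0) = ρ j (γ 0)) ∧
          ∀ f ∈ Fs, ∀ i, (f.map (eval (γ t))).eval (ρ i (γ t)) = 0 ↔
            (f.map (eval (γ 0))).eval (ρ i (γ 0)) = 0 := by
  classical
  set Q := ∏ f ∈ Fs, f with hQ
  have hQl : ConstLead Q := ConstLead.prod hF
  set D := Q.natDegree with hD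
  have hB : ∀ j : ℕ, ∃ B : MvPolynomial (Fin n) ℝ, j < D → ∀ x, 0 ≤ eval x B ∧
      ∀ y, ((Polynomial.derivative^[j] Q).map (eval x)).eval y = 0 → |y| ≤ eval x B := by
    intro j
    by_cases hj : j < D
    · obtain ⟨B, hB⟩ := (hQl.iterate_derivative hj.le).1.exists_root_bound
      exact ⟨B, fun _ => hB⟩
    · exact ⟨0, fun h => absurd h hj⟩
  choose Bj hBj using hB
  set B := ∑ j ∈ Finset.range D, Bj j with hBdef
  have hBx : ∀ x, eval x B = ∑ j ∈ Finset.range D, eval x (Bj j) := fun x => by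
    rw [hBdef, map_sum]
  have hB0 : ∀ x, 0 ≤ eval x B := fun x => by
    rw [hBx]
    exact Finset.sum_nonneg fun j hj => (hBj j (Finset.mem_range.1 hj) x).1
  have hBroot : ∀ x y j, j < D →
      ((Polynomial.derivative^[j] Q).map (eval x)).eval y = 0 → |y| ≤ eval x B := by
    intro x y j hj h
    refine ((hBj j hj x).2 y h).trans ?_
    rw [hBx]
    exact Finset.single_le_sum (f := fun j => eval x (Bj j))
      (fun j hj => (hBj j (Finset.mem_range.1 hj) x).1) (Finset.mem_range.2 hj)
  obtain ⟨ρ, h1, h2, h3, h4, h5, h6⟩ := exists_virtual_roots (MvPolynomial.continuous_eval B) hB0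
    D (fun x => Q.map (eval x)) hQl.map_ne_zero hQl.natDegree_map
    (fun j => by
      simp only [Polynomial.iterate_derivative_map]
      exact continuous_eval_map _)
    (fun x y j hj h => by
      rw [Polynomial.iterate_derivative_map] at h
      exact hBroot x y j hj h)
  set q : Polynomial (MvPolynomial (Fin n) ℝ) :=
    (Polynomial.X - Polynomial.C B) * (Polynomial.X - Polynomial.C (-B)) *
      ∏ j ∈ Finset.range (D + 1), Polynomial.derivative^[j] Q with hq
  have hql : ConstLead q := by
    refine (ConstLead.mul ⟨1, one_ne_zero, ?_⟩ ⟨1, one_ne_zero, ?_⟩).mul (ConstLead.prod fun j hj =>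
      (hQl.iterate_derivative (Nat.lt_succ_iff.1 (Finset.mem_range.1 hj))).1)
    · rw [Polynomial.leadingCoeff_X_sub_C, C_1]
    · rw [Polynomial.leadingCoeff_X_sub_C, C_1]
  have hρq : ∀ i x, (cspec q x).eval (ρ i x : ℂ) = 0 := by
    intro i x
    rw [cspec_eval_eq_zero, hq, Polynomial.map_mul, Polynomial.map_mul, Polynomial.eval_mul,
      Polynomial.eval_mul, Polynomial.map_prod, Polynomial.eval_prod]
    rcases h5 i x with h | h | ⟨j, hj, h⟩
    · simp [h]
    · simp [h]
    · rw [Polynomial.iterate_derivative_map] at h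
      exact mul_eq_zero_of_right _
        (Finset.prod_eq_zero (Finset.mem_range.2 (hj.trans D.lt_succ_self)) h)
  have hdvd : ∀ f ∈ Fs, f ∣ q := fun f hf => (Finset.dvd_prod_of_mem (fun f => f) hf).trans
    ((Finset.dvd_prod_of_mem (fun j => Polynomial.derivative^[j] Q)
      (Finset.mem_range.2 D.succ_pos)).trans (dvd_mul_left _ _))
  obtain ⟨c, hc, hcq⟩ := hql
  obtain ⟨G, hG⟩ := exists_finset_card_roots hc hcq
  refine ⟨G, D + 1, ρ, h1, h2, fun i x hi => ?_, ?_, ?_⟩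
  · rw [h4 i x (by omega), h4 (D + 1) x (by omega)]
  · intro f hf x y hy
    refine h6 x y ?_
    obtain ⟨g, hg⟩ := Finset.dvd_prod_of_mem (fun f => f) hf
    change Q = f * g at hg
    rw [hg, Polynomial.map_mul, Polynomial.eval_mul, hy, zero_mul]
  · intro γ hγ hpat t ht
    have : PreconnectedSpace (Ico (0 : ℝ) 1) :=
      Subtype.preconnectedSpace isPreconnected_Ico
    set x : Ico (0 : ℝ) 1 → Fin n → ℝ := fun s => γ s with hx
    have hxc : Continuous x := continuousOn_iff_continuous_domRestrict.1
      (hγ.mono Ico_subset_Icc_self)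
    have hcard : ∀ y y', (cspec q (x y)).roots.toFinset.card =
        (cspec q (x y')).roots.toFinset.card := fun y y' => hG _ _ fun g hg =>
      (hpat g hg y y.2).trans (hpat g hg y' y'.2).symm
    have hρc : ∀ i, Continuous fun s => ρ i (x s) := fun i => (h1 i).comp hxc
    have heq : ∀ i j (s s' : Ico (0 : ℝ) 1), ρ i (x s) = ρ j (x s) → ρ i (x s') = ρ j (x s') :=
      fun i j s s' h => eq_of_eq_of_card_roots hc hcq hxc hcard (hρc i) (hρc j)
        (fun _ => hρq _ _) (fun _ => hρq _ _) h s'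
    have hzero : ∀ f ∈ Fs, ∀ i, ∀ s s' : Ico (0 : ℝ) 1,
        (f.map (eval (x s))).eval (ρ i (x s)) = 0 →
        (f.map (eval (x s'))).eval (ρ i (x s')) = 0 := by
      intro f hf i s s' h
      obtain ⟨c', hc', hf'⟩ := hF f hf
      rw [← cspec_eval_eq_zero] at h ⊢
      refine eval_eq_zero_of_card_roots hc hcq hxc hcard (hρc i) (fun _ => hρq _ _) hc' hf'
        (hdvd f hf) ?_ h s'
      simp only [cspec_eval_ofReal]
      exact Complex.continuous_ofReal.comp ((continuous_eval_map f).comp (hxc.prodMk (hρc i)))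
    have h0 : (0 : ℝ) ∈ Ico (0 : ℝ) 1 := ⟨le_rfl, zero_lt_one⟩
    exact ⟨fun i j => ⟨heq i j ⟨t, ht⟩ ⟨0, h0⟩, heq i j ⟨0, h0⟩ ⟨t, ht⟩⟩,
      fun f hf i => ⟨hzero f hf i ⟨t, ht⟩ ⟨0, h0⟩, hzero f hf i ⟨0, h0⟩ ⟨t, ht⟩⟩⟩

end ConstLead

/-- The relative position of `y` in `[l, m]`, truncated. -/
noncomputable def relPos (l m y : ℝ) : ℝ := max 0 (min (y - l) (m - l)) / (m - l)

/-- The reparametrization of the relative position in the `i`-th gap: contraction towards the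
end `1` or `0` of a gap that persists, identity for a gap that closes up. -/
noncomputable def gapMap (J : ℕ → Prop) (a i : ℕ) (t u : ℝ) : ℝ :=
  open scoped Classical in
  if J i then (if i < a then 1 - (1 - t) * (1 - u) else (1 - t) * u) else u

/-- The map of fibres determined by two root sequences and the gap maps. -/
noncomputable def fiberMap (J : ℕ → Prop) (a M : ℕ) (r r' : ℕ → ℝ) (t y : ℝ) : ℝ :=
  r' 0 + (1 - t) * min (y - r 0) 0 + (1 - t) * max (y - r M) 0 +
    ∑ i ∈ Finset.range M, gapMap J a i t (relPos (r i) (r (i + 1)) y) * (r' (i + 1) - r' i)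

/-- The part of a fibre attached to the `a`-th root. -/
def InSlab (J : ℕ → Prop) (a : ℕ) (r : ℕ → ℝ) (y : ℝ) : Prop :=
  ∀ i, J i → (i < a → (r i + r (i + 1)) / 2 ≤ y) ∧ (a ≤ i → y ≤ (r i + r (i + 1)) / 2)

lemma relPos_nonneg {l m : ℝ} (h : l ≤ m) (y : ℝ) : 0 ≤ relPos l m y :=
  div_nonneg (le_max_left _ _) (sub_nonneg.2 h)

lemma relPos_le_one {l m : ℝ} (h : l ≤ m) (y : ℝ) : relPos l m y ≤ 1 :=
  div_le_one_of_le₀ (max_le (sub_nonneg.2 h) (min_le_right _ _)) (sub_nonneg.2 h)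

lemma relPos_eq {l m y : ℝ} (h1 : l ≤ y) (h2 : y ≤ m) : relPos l m y = (y - l) / (m - l) := by
  rw [relPos, min_eq_left (by linarith), max_eq_right (by linarith)]

lemma relPos_eq_one {l m y : ℝ} (h : l < m) (h1 : m ≤ y) : relPos l m y = 1 := by
  rw [relPos, min_eq_right (by linarith), max_eq_right (by linarith), div_self (by linarith)]

lemma relPos_eq_zero {l m y : ℝ} (h1 : y ≤ l) : relPos l m y = 0 := by
  rw [relPos, max_eq_left ((min_le_left _ _).trans (by linarith)), zero_div]

section gapMap
variable {J : ℕ → Prop} {a i : ℕ} {t u : ℝ}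

lemma gapMap_mem_Icc (ht : t ∈ Icc (0 : ℝ) 1) (hu : u ∈ Icc (0 : ℝ) 1) :
    gapMap J a i t u ∈ Icc (0 : ℝ) 1 := by
  obtain ⟨h1, h2⟩ := ht
  obtain ⟨h3, h4⟩ := hu
  unfold gapMap
  split_ifs
  · constructor <;> nlinarith [mul_nonneg (sub_nonneg.2 h2) (sub_nonneg.2 h4)]
  · constructor <;> nlinarith [mul_nonneg (sub_nonneg.2 h2) h3]
  · exact ⟨h3, h4⟩

lemma gapMap_pos (ht : t ∈ Ico (0 : ℝ) 1) (hu : u ∈ Icc (0 : ℝ) 1) (h0 : 0 < u) :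
    0 < gapMap J a i t u := by
  obtain ⟨h1, h2⟩ := ht
  obtain ⟨h3, h4⟩ := hu
  unfold gapMap
  split_ifs
  · nlinarith [mul_nonneg h1 (sub_nonneg.2 h4)]
  · exact mul_pos (sub_pos.2 h2) h0
  · exact h0

lemma gapMap_lt_one (ht : t ∈ Ico (0 : ℝ) 1) (hu : u ∈ Icc (0 : ℝ) 1) (h0 : u < 1) :
    gapMap J a i t u < 1 := by
  obtain ⟨h1, h2⟩ := ht
  obtain ⟨h3, h4⟩ := hu
  unfold gapMap
  split_ifs
  · nlinarith [mul_pos (sub_pos.2 h2) (sub_pos.2 h0)]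
  · nlinarith [mul_nonneg h1 h3]
  · exact h0

end gapMap

section fiberMap
variable {J : ℕ → Prop} {a M : ℕ} {r r' : ℕ → ℝ} {t y : ℝ}

lemma sum_gap (r : ℕ → ℝ) (j : ℕ) : ∑ i ∈ Finset.range j, (r (i + 1) - r i) = r j - r 0 :=
  Finset.sum_range_sub r j

lemma gapMap_term_of_le (hr : Monotone r) (h0 : ∀ i, r i = r (i + 1) → r' i = r' (i + 1))
    (hs : InSlab J a r y) {i : ℕ} (hi : r (i + 1) ≤ y) :
    gapMap J a i t (relPos (r i) (r (i + 1)) y) * (r' (i + 1) - r' i) = r' (i + 1) - r' i := by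
  rcases (hr i.le_succ).eq_or_lt with h | h
  · simp [h0 i h]
  rw [relPos_eq_one h hi]
  unfold gapMap
  split_ifs with hj hia
  · ring
  · have := (hs i hj).2 (not_lt.1 hia)
    change r i < r (i + 1) at h
    linarith
  · ring

lemma gapMap_term_of_ge (hr : Monotone r) (h0 : ∀ i, r i = r (i + 1) → r' i = r' (i + 1))
    (hs : InSlab J a r y) {i : ℕ} (hi : y ≤ r i) :
    gapMap J a i t (relPos (r i) (r (i + 1)) y) * (r' (i + 1) - r' i) = 0 := by
  rcases (hr i.le_succ).eq_or_lt with h | h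
  · simp [h0 i h]
  rw [relPos_eq_zero hi]
  unfold gapMap
  split_ifs with hj hia
  · have := (hs i hj).1 hia
    change r i < r (i + 1) at h
    linarith
  · ring
  · ring

/-- The position of a point relative to a sequence. -/
lemma cases_position (M : ℕ) (r : ℕ → ℝ) (y : ℝ) :
    y ≤ r 0 ∨ r M < y ∨ ∃ j < M, r j < y ∧ y ≤ r (j + 1) := by
  by_contra hno
  push Not at hno
  obtain ⟨h1, h2, h3⟩ := hno
  have : ∀ j ≤ M, r j < y := by
    intro j
    induction j with
    | zero => exact fun _ => h1
    | succ j ih => exact fun hj => h3 j hj (ih (by omega))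
  exact absurd (this M le_rfl) (not_lt.2 h2)

lemma cases_position' (M : ℕ) (r : ℕ → ℝ) (y : ℝ) :
    y < r 0 ∨ r M ≤ y ∨ ∃ j < M, r j ≤ y ∧ y < r (j + 1) := by
  by_contra hno
  push Not at hno
  obtain ⟨h1, h2, h3⟩ := hno
  have : ∀ j ≤ M, r j ≤ y := by
    intro j
    induction j with
    | zero => exact fun _ => h1
    | succ j ih => exact fun hj => h3 j hj (ih (by omega))
  exact absurd (this M le_rfl) (not_le.2 h2)

/-- Two root sequences and a point of a slab, with the gap pattern of the first
sequence passing to the second one. -/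
structure SlabData (J : ℕ → Prop) (a M : ℕ) (r r' : ℕ → ℝ) (t y : ℝ) : Prop where
  mono : Monotone r
  mono' : Monotone r'
  gap : ∀ i, r i = r (i + 1) → r' i = r' (i + 1)
  lt : ∀ i, J i → r i < r (i + 1)
  ht : t ∈ Icc (0 : ℝ) 1
  slab : InSlab J a r y
  const : ∀ i, M ≤ i → r i = r M
  const' : ∀ i, M ≤ i → r' i = r' M

namespace SlabData
variable (h : SlabData J a M r r' t y)
include h

lemma relPos_mem (i : ℕ) : relPos (r i) (r (i + 1)) y ∈ Icc (0 : ℝ) 1 :=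
  ⟨relPos_nonneg (h.mono i.le_succ) y, relPos_le_one (h.mono i.le_succ) y⟩

lemma term_nonneg (i : ℕ) :
    0 ≤ gapMap J a i t (relPos (r i) (r (i + 1)) y) * (r' (i + 1) - r' i) :=
  mul_nonneg (gapMap_mem_Icc h.ht (h.relPos_mem i)).1 (sub_nonneg.2 (h.mono' i.le_succ))

lemma term_le (i : ℕ) :
    gapMap J a i t (relPos (r i) (r (i + 1)) y) * (r' (i + 1) - r' i) ≤ r' (i + 1) - r' i :=
  mul_le_of_le_one_left (sub_nonneg.2 (h.mono' i.le_succ))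
    (gapMap_mem_Icc h.ht (h.relPos_mem i)).2

lemma fiberMap_of_ge (hy : y ≤ r 0) :
    fiberMap J a M r r' t y = r' 0 + (1 - t) * (y - r 0) := by
  rw [fiberMap, Finset.sum_eq_zero fun i _ => gapMap_term_of_ge h.mono h.gap h.slab
    (hy.trans (h.mono i.zero_le)), min_eq_left (by linarith),
    max_eq_right (by linarith [h.mono M.zero_le])]
  ring

lemma fiberMap_of_le (hy : r M ≤ y) :
    fiberMap J a M r r' t y = r' M + (1 - t) * (y - r M) := by
  rw [fiberMap, Finset.sum_congr rfl fun i hi => gapMap_term_of_le h.mono h.gap h.slab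
    ((h.mono (Finset.mem_range.1 hi)).trans hy), sum_gap,
    min_eq_right (by linarith [h.mono M.zero_le]), max_eq_left (by linarith)]
  ring

lemma fiberMap_of_mem {j : ℕ} (hj : j < M) (h1 : r j ≤ y) (h2 : y ≤ r (j + 1)) :
    fiberMap J a M r r' t y =
      r' j + gapMap J a j t (relPos (r j) (r (j + 1)) y) * (r' (j + 1) - r' j) := by
  rw [fiberMap, ← Finset.sum_range_add_sum_Ico _ hj.le, Finset.sum_eq_sum_Ico_succ_bot hj,
    Finset.sum_congr rfl fun i hi => gapMap_term_of_le h.mono h.gap h.slab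
      ((h.mono (Finset.mem_range.1 hi)).trans h1), sum_gap,
    Finset.sum_eq_zero (s := Finset.Ico (j + 1) M) fun i hi =>
      gapMap_term_of_ge h.mono h.gap h.slab
        (h2.trans (h.mono (Finset.mem_Ico.1 hi).1)),
    min_eq_right (by linarith [h.mono j.zero_le]),
    max_eq_right (by linarith [h.mono (Nat.succ_le_of_lt hj)])]
  ring

lemma le_fiberMap {j : ℕ} (hy : r j ≤ y) : r' j ≤ fiberMap J a M r r' t y := by
  have ht := sub_nonneg.2 h.ht.2
  rcases le_total M j with hMj | hMj
  · rw [h.const j hMj] at hy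
    rw [h.const' j hMj, h.fiberMap_of_le hy]
    nlinarith [mul_nonneg ht (sub_nonneg.2 hy)]
  rcases cases_position' M r y with h1 | h1 | ⟨k, hk, h1, h2⟩
  · exact absurd (hy.trans_lt h1) (not_lt.2 (h.mono j.zero_le))
  · rw [h.fiberMap_of_le h1]
    nlinarith [mul_nonneg ht (sub_nonneg.2 h1), h.mono' hMj]
  · rw [h.fiberMap_of_mem hk h1 h2.le]
    rcases le_or_gt j k with hjk | hjk
    · linarith [h.mono' hjk, h.term_nonneg k]
    · exact absurd (((h.mono hjk).trans hy).trans_lt h2) (lt_irrefl _)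

lemma le_const (j : ℕ) : r j ≤ r M := by
  rcases le_total j M with hj | hj
  · exact h.mono hj
  · rw [h.const _ hj]

lemma le_const' (j : ℕ) : r' j ≤ r' M := by
  rcases le_total j M with hj | hj
  · exact h.mono' hj
  · rw [h.const' _ hj]

lemma fiberMap_le {j : ℕ} (hy : y ≤ r j) : fiberMap J a M r r' t y ≤ r' j := by
  have ht := sub_nonneg.2 h.ht.2
  rcases cases_position M r y with h1 | h1 | ⟨k, hk, h1, h2⟩
  · rw [h.fiberMap_of_ge h1]
    nlinarith [mul_nonneg ht (sub_nonneg.2 h1), h.mono' j.zero_le]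
  · exact absurd (hy.trans (h.le_const j)) (not_le.2 h1)
  · rw [h.fiberMap_of_mem hk h1.le h2]
    rcases lt_or_ge k j with hjk | hjk
    · linarith [h.mono' (Nat.succ_le_of_lt hjk), h.term_le k]
    · exact absurd ((hy.trans (h.mono hjk)).trans_lt h1) (lt_irrefl _)

lemma fiberMap_eq {j : ℕ} (hy : y = r j) : fiberMap J a M r r' t y = r' j :=
  le_antisymm (h.fiberMap_le hy.le) (h.le_fiberMap hy.ge)

lemma lt_fiberMap (hgap : ∀ i, r' i = r' (i + 1) → r i = r (i + 1)) (ht : t < 1) {j : ℕ}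
    (hy : r j < y) : r' j < fiberMap J a M r r' t y := by
  have ht' := sub_pos.2 ht
  rcases cases_position M r y with h1 | h1 | ⟨k, hk, h1, h2⟩
  · exact absurd (hy.trans_le h1) (not_lt.2 (h.mono j.zero_le))
  · rw [h.fiberMap_of_le h1.le]
    nlinarith [mul_pos ht' (sub_pos.2 h1), h.le_const' j]
  · have hkk : r k < r (k + 1) := h1.trans_le h2
    have hjk : j ≤ k := by
      by_contra hjk
      exact absurd (hy.trans_le h2) (not_lt.2 (h.mono (not_le.1 hjk)))
    have hg : r' k < r' (k + 1) := lt_of_le_of_ne (h.mono' k.le_succ) fun e => hkk.ne (hgap k e)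
    rw [h.fiberMap_of_mem hk h1.le h2]
    have hp : 0 < relPos (r k) (r (k + 1)) y := by
      rw [relPos_eq h1.le h2]
      exact div_pos (sub_pos.2 h1) (sub_pos.2 hkk)
    have := mul_pos (gapMap_pos (J := J) (a := a) (i := k) ⟨h.ht.1, ht⟩ (h.relPos_mem k) hp)
      (sub_pos.2 hg)
    linarith [h.mono' hjk]

lemma fiberMap_lt (hgap : ∀ i, r' i = r' (i + 1) → r i = r (i + 1)) (ht : t < 1) {j : ℕ}
    (hy : y < r j) : fiberMap J a M r r' t y < r' j := by
  have ht' := sub_pos.2 ht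
  rcases cases_position' M r y with h1 | h1 | ⟨k, hk, h1, h2⟩
  · rw [h.fiberMap_of_ge h1.le]
    nlinarith [mul_pos ht' (sub_pos.2 h1), h.mono' j.zero_le]
  · exact absurd (hy.trans_le (h.le_const j)) (not_lt.2 h1)
  · have hkk : r k < r (k + 1) := h1.trans_lt h2
    have hjk : k + 1 ≤ j := by
      by_contra hjk
      exact absurd (hy.trans_le (h.mono (show j ≤ k by omega))) (not_lt.2 h1)
    have hg : r' k < r' (k + 1) := lt_of_le_of_ne (h.mono' k.le_succ) fun e => hkk.ne (hgap k e)
    rw [h.fiberMap_of_mem hk h1 h2.le]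
    have hp : relPos (r k) (r (k + 1)) y < 1 := by
      rw [relPos_eq h1 h2.le, div_lt_one (sub_pos.2 hkk)]
      linarith
    have := mul_lt_of_lt_one_left (sub_pos.2 hg)
      (gapMap_lt_one (J := J) (a := a) (i := k) ⟨h.ht.1, ht⟩ (h.relPos_mem k) hp)
    linarith [h.mono' hjk]

/-- The fibre maps preserve the vanishing on root sequences. -/
lemma fiberMap_eq_iff (hgap : ∀ i, r' i = r' (i + 1) → r i = r (i + 1)) (ht : t < 1) {j : ℕ} :
    fiberMap J a M r r' t y = r' j ↔ y = r j := by
  refine ⟨fun he => ?_, h.fiberMap_eq⟩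
  rcases lt_trichotomy y (r j) with h1 | h1 | h1
  · exact absurd he (h.fiberMap_lt hgap ht h1).ne
  · exact h1
  · exact absurd he (h.lt_fiberMap hgap ht h1).ne'

lemma inSlab_fiberMap : InSlab J a r' (fiberMap J a M r r' t y) := by
  intro i hi
  have hlt := h.lt i hi
  have hg : 0 ≤ r' (i + 1) - r' i := sub_nonneg.2 (h.mono' i.le_succ)
  have hiM : i < M := by
    by_contra hiM
    rw [h.const i (by omega), h.const (i + 1) (by omega)] at hlt
    exact lt_irrefl _ hlt
  obtain ⟨ht0, ht1⟩ := h.ht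
  constructor
  · intro hia
    have h1 := (h.slab i hi).1 hia
    rcases le_total (r (i + 1)) y with h2 | h2
    · linarith [h.le_fiberMap h2]
    · have h3 : r i ≤ y := by linarith
      rw [h.fiberMap_of_mem hiM h3 h2, relPos_eq h3 h2]
      have h4 : 1 / 2 ≤ (y - r i) / (r (i + 1) - r i) := by
        rw [div_le_div_iff₀ two_pos (sub_pos.2 hlt)]
        linarith
      have h5 : (y - r i) / (r (i + 1) - r i) ≤ 1 :=
        div_le_one_of_le₀ (by linarith) (by linarith)
      have h6 : 1 / 2 ≤ gapMap J a i t ((y - r i) / (r (i + 1) - r i)) := by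
        rw [gapMap, if_pos hi, if_pos hia]
        nlinarith [mul_nonneg ht0 (sub_nonneg.2 h5)]
      nlinarith [mul_le_mul_of_nonneg_right h6 hg]
  · intro hia
    have h1 := (h.slab i hi).2 hia
    rcases le_total y (r i) with h2 | h2
    · linarith [h.fiberMap_le h2]
    · have h3 : y ≤ r (i + 1) := by linarith
      rw [h.fiberMap_of_mem hiM h2 h3, relPos_eq h2 h3]
      have h4 : (y - r i) / (r (i + 1) - r i) ≤ 1 / 2 := by
        rw [div_le_div_iff₀ (sub_pos.2 hlt) two_pos]
        linarith
      have h5 : 0 ≤ (y - r i) / (r (i + 1) - r i) :=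
        div_nonneg (by linarith) (by linarith)
      have h6 : gapMap J a i t ((y - r i) / (r (i + 1) - r i)) ≤ 1 / 2 := by
        rw [gapMap, if_pos hi, if_neg (not_lt.2 hia)]
        nlinarith [mul_nonneg ht0 h5]
      nlinarith [mul_le_mul_of_nonneg_right h6 hg]

end SlabData

/-- At time zero the fibre map is the identity. -/
lemma fiberMap_zero (hr : Monotone r) (hs : InSlab J a r y) (hJ : ∀ i, J i → r i < r (i + 1))
    (hM : ∀ i, M ≤ i → r i = r M) : fiberMap J a M r r 0 y = y := by
  have h : SlabData J a M r r 0 y := ⟨hr, hr, fun _ h => h, hJ, ⟨le_rfl, zero_le_one⟩, hs, hM, hM⟩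
  rcases cases_position M r y with h1 | h1 | ⟨k, hk, h1, h2⟩
  · rw [h.fiberMap_of_ge h1]; ring
  · rw [h.fiberMap_of_le h1.le]; ring
  · rw [h.fiberMap_of_mem hk h1.le h2, relPos_eq h1.le h2]
    have hkk : r (k + 1) - r k ≠ 0 := (sub_pos.2 (h1.trans_le h2)).ne'
    have : gapMap J a k 0 ((y - r k) / (r (k + 1) - r k)) = (y - r k) / (r (k + 1) - r k) := by
      unfold gapMap
      split_ifs <;> ring
    rw [this, div_mul_cancel₀ _ hkk]
    ring

/-- At time one the fibre map is constant. -/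
lemma fiberMap_one (hJ : ∀ i, ¬ J i → r' i = r' (i + 1)) (ha : a ≤ M) :
    fiberMap J a M r r' 1 y = r' a := by
  have h1 : ∀ i, gapMap J a i 1 (relPos (r i) (r (i + 1)) y) * (r' (i + 1) - r' i) =
      if i < a then r' (i + 1) - r' i else 0 := by
    intro i
    unfold gapMap
    by_cases hi : J i
    · by_cases hia : i < a <;> simp [hi, hia]
    · simp [hJ i hi]
  rw [fiberMap, Finset.sum_congr rfl fun i _ => h1 i, ← Finset.sum_filter]
  have : (Finset.range M).filter (fun i => i < a) = Finset.range a := by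
    ext i
    simp only [Finset.mem_filter, Finset.mem_range]
    omega
  rw [this, sum_gap]
  ring

/-- When the root sequence does not move the fibre maps are affine in time. -/
lemma fiberMap_self (hr : Monotone r) (hs : InSlab J a r y) (hJ : ∀ i, J i ↔ r i < r (i + 1))
    (hM : ∀ i, M ≤ i → r i = r M) (ha : a ≤ M) :
    fiberMap J a M r r t y = (1 - t) * y + t * r a := by
  have hJ' : ∀ i, ¬ J i → r i = r (i + 1) := fun i hi =>
    le_antisymm (hr i.le_succ) (not_lt.1 fun h => hi ((hJ i).2 h))
  have h0 := fiberMap_zero hr hs (fun i hi => (hJ i).1 hi) hM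
  have h1 := fiberMap_one (J := J) (r := r) (y := y) hJ' ha
  conv_rhs => rw [← h0, ← h1]
  have h2 : ∀ i u, gapMap J a i t u * (r (i + 1) - r i) =
      (1 - t) * (gapMap J a i 0 u * (r (i + 1) - r i)) +
        t * (gapMap J a i 1 u * (r (i + 1) - r i)) := by
    intro i u
    unfold gapMap
    split_ifs <;> ring
  unfold fiberMap
  rw [Finset.sum_congr rfl fun i _ => h2 i _, Finset.sum_add_distrib, ← Finset.mul_sum,
    ← Finset.mul_sum]
  ring

end fiberMap

/-- A contraction `h` of the closed set `N` to the point `b`, moving each point along an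
injective path, and such that membership in the sets of `𝓩` does not change before the end. -/
structure IsTrackContraction {X : Type*} [TopologicalSpace X] (𝓩 : Set (Set X)) (N : Set X)
    (b : X) (h : ℝ → X → X) : Prop where
  isClosed : IsClosed N
  continuousOn : ContinuousOn (fun z : ℝ × X => h z.1 z.2) (Icc 0 1 ×ˢ N)
  mapsTo : ∀ x ∈ N, ∀ t ∈ Icc (0 : ℝ) 1, h t x ∈ N
  zero : ∀ x ∈ N, h 0 x = x
  one : ∀ x ∈ N, h 1 x = b
  center_mem : b ∈ N
  center : ∀ t ∈ Icc (0 : ℝ) 1, h t b = b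
  injOn : ∀ x ∈ N, x ≠ b → InjOn (fun t => h t x) (Icc 0 1)
  mem_iff : ∀ Z ∈ 𝓩, ∀ x ∈ N, ∀ t ∈ Ico (0 : ℝ) 1, h t x ∈ Z ↔ x ∈ Z

lemma IsTrackContraction.continuousOn_track {X : Type*} [TopologicalSpace X] {𝓩 : Set (Set X)}
    {N : Set X} {b : X} {h : ℝ → X → X} (hN : IsTrackContraction 𝓩 N b h) {x : X} (hx : x ∈ N) :
    ContinuousOn (fun t => h t x) (Icc 0 1) :=
  hN.continuousOn.comp (f := fun t : ℝ => (t, x)) (by fun_prop) fun _ ht => ⟨ht, hx⟩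

lemma continuous_gapMap (J : ℕ → Prop) (a i : ℕ) :
    Continuous fun z : ℝ × ℝ => gapMap J a i z.1 z.2 := by
  unfold gapMap
  split_ifs <;> fun_prop

section slab
variable {X : Type*} [TopologicalSpace X] {𝓩 : Set (Set X)} {N : Set X} {b : X} {h : ℝ → X → X}
  {M : ℕ} {ρ : ℕ → X → ℝ}

/-- Root functions `ρ` whose coincidences do not change along a contraction, before the end. -/
structure AdaptedRoots (N : Set X) (h : ℝ → X → X) (M : ℕ) (ρ : ℕ → X → ℝ) : Prop where
  continuous : ∀ i, Continuous (ρ i)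
  mono : ∀ x, Monotone fun i => ρ i x
  const : ∀ x i, M ≤ i → ρ i x = ρ M x
  eq_iff : ∀ x ∈ N, ∀ t ∈ Ico (0 : ℝ) 1, ∀ i j, ρ i (h t x) = ρ j (h t x) ↔ ρ i x = ρ j x

lemma AdaptedRoots.eq_of_eq (hρ : AdaptedRoots N h M ρ) (hN : IsTrackContraction 𝓩 N b h)
    {x : X} (hx : x ∈ N) {t : ℝ} (ht : t ∈ Icc (0 : ℝ) 1) {i j : ℕ} (he : ρ i x = ρ j x) :
    ρ i (h t x) = ρ j (h t x) := by
  have hc : ∀ i, ContinuousOn (fun t => ρ i (h t x)) (Icc 0 1) := fun i =>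
    (hρ.continuous i).comp_continuousOn (hN.continuousOn_track hx)
  have h1 : EqOn (fun t => ρ i (h t x)) (fun t => ρ j (h t x)) (Ico 0 1) := fun t ht =>
    (hρ.eq_iff x hx t ht i j).2 he
  have h2 := h1.of_subset_closure (hc i) (hc j) Ico_subset_Icc_self
    (by rw [closure_Ico zero_ne_one])
  exact h2 ht

lemma AdaptedRoots.lt_of_lt (hρ : AdaptedRoots N h M ρ) (hN : IsTrackContraction 𝓩 N b h)
    {x : X} (hx : x ∈ N) {i : ℕ} (hi : ρ i b < ρ (i + 1) b) : ρ i x < ρ (i + 1) x := by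
  refine lt_of_le_of_ne (hρ.mono x i.le_succ) fun he => hi.ne ?_
  have := hρ.eq_of_eq hN hx ⟨zero_le_one, le_rfl⟩ he
  rwa [hN.one x hx] at this

lemma AdaptedRoots.slabData (hρ : AdaptedRoots N h M ρ) (hN : IsTrackContraction 𝓩 N b h)
    {a : ℕ} {x : X} (hx : x ∈ N) {t y : ℝ} (ht : t ∈ Icc (0 : ℝ) 1)
    (hy : InSlab (fun i => ρ i b < ρ (i + 1) b) a (fun i => ρ i x) y) :
    SlabData (fun i => ρ i b < ρ (i + 1) b) a M (fun i => ρ i x) (fun i => ρ i (h t x)) t y where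
  mono := hρ.mono x
  mono' := hρ.mono _
  gap _ he := hρ.eq_of_eq hN hx ht he
  lt _ hi := hρ.lt_of_lt hN hx hi
  ht := ht
  slab := hy
  const := hρ.const x
  const' := hρ.const _

lemma AdaptedRoots.continuousOn_fiberMap (hρ : AdaptedRoots N h M ρ)
    (hN : IsTrackContraction 𝓩 N b h) (a : ℕ) :
    ContinuousOn (fun z : ℝ × (X × ℝ) => fiberMap (fun i => ρ i b < ρ (i + 1) b) a M
        (fun i => ρ i z.2.1) (fun i => ρ i (h z.1 z.2.1)) z.1 z.2.2)
      (Icc 0 1 ×ˢ {p | p.1 ∈ N ∧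
        InSlab (fun i => ρ i b < ρ (i + 1) b) a (fun i => ρ i p.1) p.2}) := by
  have hc : ∀ i, ContinuousOn (fun z : ℝ × (X × ℝ) => ρ i (h z.1 z.2.1))
      (Icc 0 1 ×ˢ {p | p.1 ∈ N ∧
        InSlab (fun i => ρ i b < ρ (i + 1) b) a (fun i => ρ i p.1) p.2}) := fun i =>
    (hρ.continuous i).comp_continuousOn (hN.continuousOn.comp
      (f := fun z : ℝ × (X × ℝ) => (z.1, z.2.1)) (by fun_prop) fun z hz => ⟨hz.1, hz.2.1⟩)
  unfold fiberMap
  refine ContinuousOn.add (((hc 0).add (Continuous.continuousOn ?_)).add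
    (Continuous.continuousOn ?_)) (continuousOn_finsetSum _ fun i _ => ?_)
  · have := hρ.continuous 0
    dsimp only
    fun_prop
  · have := hρ.continuous M
    dsimp only
    fun_prop
  · intro z hz
    have hg := ((hc (i + 1)).sub (hc i)) z hz
    rcases (hρ.mono z.2.1 i.le_succ).eq_or_lt with he | hlt
    · have h0 : ρ (i + 1) (h z.1 z.2.1) - ρ i (h z.1 z.2.1) = 0 := by
        rw [hρ.eq_of_eq hN hz.2.1 hz.1 he, sub_self]
      have hg' : Filter.Tendsto
          (fun w : ℝ × (X × ℝ) => ρ (i + 1) (h w.1 w.2.1) - ρ i (h w.1 w.2.1))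
          (nhdsWithin z (Icc 0 1 ×ˢ {p | p.1 ∈ N ∧
            InSlab (fun i => ρ i b < ρ (i + 1) b) a (fun i => ρ i p.1) p.2})) (nhds 0) := by
        refine Filter.Tendsto.mono_right hg (le_of_eq (congrArg nhds h0))
      unfold ContinuousWithinAt
      simp only [h0, mul_zero]
      refine squeeze_zero' ?_ ?_ hg'
      · filter_upwards [self_mem_nhdsWithin] with w hw
        exact (hρ.slabData hN hw.2.1 hw.1 hw.2.2).term_nonneg i
      · filter_upwards [self_mem_nhdsWithin] with w hw
        exact (hρ.slabData hN hw.2.1 hw.1 hw.2.2).term_le i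
    · refine ContinuousWithinAt.mul ?_ hg
      have h1 := hρ.continuous i
      have h2 := hρ.continuous (i + 1)
      have h3 : ContinuousAt (fun z : ℝ × (X × ℝ) =>
          (z.1, relPos (ρ i z.2.1) (ρ (i + 1) z.2.1) z.2.2)) z := by
        unfold relPos
        exact continuousAt_fst.prodMk
          (ContinuousAt.div (by fun_prop) (by fun_prop) (sub_pos.2 hlt).ne')
      exact ((continuous_gapMap (fun i => ρ i b < ρ (i + 1) b) a i).continuousAt.comp
        (f := fun z : ℝ × (X × ℝ) =>
          (z.1, relPos (ρ i z.2.1) (ρ (i + 1) z.2.1) z.2.2)) h3).continuousWithinAt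

/-- Lifting a contraction to a slab over it. -/
lemma IsTrackContraction.slab (hN : IsTrackContraction 𝓩 N b h) (hρ : AdaptedRoots N h M ρ)
    {a : ℕ} (ha : a ≤ M) {𝓩' : Set (Set (X × ℝ))}
    (hZ : ∀ Z ∈ 𝓩', Z = univ ∨ ((∀ p ∈ Z, ∃ i, ρ i p.1 = p.2) ∧
      ∀ x ∈ N, ∀ t ∈ Ico (0 : ℝ) 1, ∀ i, (h t x, ρ i (h t x)) ∈ Z ↔ (x, ρ i x) ∈ Z)) :
    IsTrackContraction 𝓩'
      {p | p.1 ∈ N ∧ InSlab (fun i => ρ i b < ρ (i + 1) b) a (fun i => ρ i p.1) p.2}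
      (b, ρ a b)
      (fun t p => (h t p.1, fiberMap (fun i => ρ i b < ρ (i + 1) b) a M
        (fun i => ρ i p.1) (fun i => ρ i (h t p.1)) t p.2)) where
  isClosed := by
    refine (hN.isClosed.preimage continuous_fst).inter ?_
    change IsClosed {p : X × ℝ | ∀ i, _}
    simp only [ofPred_forall]
    refine isClosed_iInter fun i => isClosed_iInter fun hi => ?_
    have h1 := hρ.continuous i
    have h2 := hρ.continuous (i + 1)
    simp only [ofPred_and, ofPred_forall]
    refine IsClosed.inter (isClosed_iInter fun _ => ?_) (isClosed_iInter fun _ => ?_)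
    · exact isClosed_le (by fun_prop) (by fun_prop)
    · exact isClosed_le (by fun_prop) (by fun_prop)
  continuousOn := by
    refine ContinuousOn.prodMk ?_ (hρ.continuousOn_fiberMap hN a)
    exact hN.continuousOn.comp
      (f := fun z : ℝ × (X × ℝ) => (z.1, z.2.1)) (by fun_prop) fun z hz => ⟨hz.1, hz.2.1⟩
  mapsTo p hp t ht := ⟨hN.mapsTo _ hp.1 t ht, (hρ.slabData hN hp.1 ht hp.2).inSlab_fiberMap⟩
  zero p hp := by
    ext1
    · exact hN.zero _ hp.1
    · simp only [hN.zero _ hp.1]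
      exact fiberMap_zero (hρ.mono _) hp.2 (fun i hi => hρ.lt_of_lt hN hp.1 hi) (hρ.const _)
  one p hp := by
    ext1
    · exact hN.one _ hp.1
    · simp only [hN.one _ hp.1]
      exact fiberMap_one (fun i hi => le_antisymm (hρ.mono b i.le_succ) (not_lt.1 hi)) ha
  center_mem := by
    refine ⟨hN.center_mem, fun i hi => ⟨fun hia => ?_, fun hia => ?_⟩⟩
    · have := hρ.mono b (show i + 1 ≤ a from hia)
      simp only at this ⊢
      linarith
    · have := hρ.mono b hia
      simp only at this ⊢
      linarith
  center t ht := by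
    ext1
    · exact hN.center t ht
    · simp only [hN.center t ht]
      rw [fiberMap_self (hρ.mono b) ?_ (fun _ => Iff.rfl) (hρ.const b) ha]
      · ring
      · intro i hi
        refine ⟨fun hia => ?_, fun hia => ?_⟩
        · have := hρ.mono b (show i + 1 ≤ a from hia)
          simp only at this ⊢
          linarith
        · have := hρ.mono b hia
          simp only at this ⊢
          linarith
  injOn := by
    rintro ⟨x, y⟩ hp hne s hs t ht hst
    simp only [Prod.mk.injEq] at hst
    by_cases hx : x = b
    · subst hx
      have hy : y - ρ a x ≠ 0 := fun h0 => hne (by rw [sub_eq_zero.1 h0])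
      have h1 := hst.2
      rw [hN.center s hs, hN.center t ht,
        fiberMap_self (hρ.mono x) hp.2 (fun _ => Iff.rfl) (hρ.const x) ha,
        fiberMap_self (hρ.mono x) hp.2 (fun _ => Iff.rfl) (hρ.const x) ha] at h1
      exact mul_right_cancel₀ hy (by linarith)
    · exact hN.injOn x hp.1 hx hs ht hst.1
  mem_iff Z hZ' p hp t ht := by
    obtain ⟨x, y⟩ := p
    rcases hZ Z hZ' with rfl | ⟨h1, h2⟩
    · simp
    have hd := hρ.slabData hN hp.1 (Ico_subset_Icc_self ht) hp.2
    have he := fun j => hd.fiberMap_eq_iff (fun i hi => (hρ.eq_iff x hp.1 t ht _ _).1 hi) ht.2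
      (j := j)
    constructor
    · intro hm
      obtain ⟨j, hj⟩ := h1 _ hm
      have hj' := (he j).1 hj.symm
      simp only at hj hj' hm
      rw [← hj] at hm
      rw [hj']
      exact (h2 x hp.1 t ht j).1 hm
    · intro hm
      obtain ⟨j, hj⟩ := h1 _ hm
      have hj' := (he j).2 hj.symm
      simp only at hj hj' hm
      rw [← hj] at hm
      have := (h2 x hp.1 t ht j).2 hm
      simp only
      rwa [hj']

end slab

section slabCover
open scoped Classical in
/-- The slabs cover the fibre. -/
lemma exists_inSlab (J : ℕ → Prop) (M : ℕ) {r : ℕ → ℝ} (hr : Monotone r)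
    (hJ : ∀ i, J i → r i < r (i + 1)) (hM : ∀ i, M ≤ i → r i = r M) (y : ℝ) :
    ∃ a ≤ M, (∀ j, a = j + 1 → J j) ∧ InSlab J a r y := by
  have hJM : ∀ i, J i → i < M := by
    intro i hi
    by_contra hiM
    have := hJ i hi
    rw [hM i (by omega), hM (i + 1) (by omega)] at this
    exact lt_irrefl _ this
  set s := (Finset.range M).filter fun i => J i ∧ (r i + r (i + 1)) / 2 ≤ y with hs
  have hmem : ∀ i, i ∈ s ↔ J i ∧ (r i + r (i + 1)) / 2 ≤ y := fun i => by
    simp only [hs, Finset.mem_filter, Finset.mem_range, and_iff_right_iff_imp]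
    exact fun hi => hJM i hi.1
  have hmid : ∀ i j, i ≤ j → (r i + r (i + 1)) / 2 ≤ (r j + r (j + 1)) / 2 := fun i j hij => by
    linarith [hr hij, hr (Nat.succ_le_succ hij)]
  rcases s.eq_empty_or_nonempty with h0 | h0
  · refine ⟨0, M.zero_le, fun j hj => by omega, fun i hi => ⟨fun h => by omega, fun _ => ?_⟩⟩
    by_contra hy
    have := (hmem i).2 ⟨hi, (not_le.1 hy).le⟩
    simp [h0] at this
  · have h1 := (hmem _).1 (s.max'_mem h0)
    refine ⟨s.max' h0 + 1, hJM _ h1.1, fun j hj => by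
      obtain rfl : s.max' h0 = j := by omega
      exact h1.1, fun i hi => ⟨fun h => ?_, fun h => ?_⟩⟩
    · exact (hmid i _ (by omega)).trans h1.2
    · by_contra hy
      have := s.le_max' i ((hmem i).2 ⟨hi, (not_le.1 hy).le⟩)
      omega

open scoped Classical in
/-- The parity of the number of gaps below a slab. -/
noncomputable def slabParity (J : ℕ → Prop) (a : ℕ) : Bool :=
  ((Finset.range a).filter J).card.bodd

open scoped Classical in
lemma not_inSlab_of_lt {J : ℕ → Prop} {a a' : ℕ} (haa : a < a') {r : ℕ → ℝ} (hr : Monotone r)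
    (hJ : ∀ i, J i → r i < r (i + 1)) (ha' : ∀ j, a' = j + 1 → J j)
    (hp : slabParity J a = slabParity J a') {y : ℝ} (h : InSlab J a r y) :
    ¬ InSlab J a' r y := by
  intro h'
  obtain ⟨j, rfl⟩ : ∃ j, a' = j + 1 := ⟨a' - 1, by omega⟩
  have hj := ha' j rfl
  obtain ⟨i, hi, hai, hij⟩ : ∃ i, J i ∧ a ≤ i ∧ i < j := by
    by_contra hno
    push Not at hno
    have h1 : (Finset.range (j + 1)).filter J = insert j ((Finset.range a).filter J) := by
      ext i
      simp only [Finset.mem_filter, Finset.mem_range, Finset.mem_insert]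
      constructor
      · rintro ⟨h1, h2⟩
        by_cases h3 : i < a
        · exact Or.inr ⟨h3, h2⟩
        · have := hno i h2 (by omega)
          left; omega
      · rintro (rfl | ⟨h1, h2⟩)
        · exact ⟨by omega, hj⟩
        · exact ⟨by omega, h2⟩
    rw [slabParity, slabParity, h1, Finset.card_insert_of_notMem, Nat.bodd_succ] at hp
    · cases h : ((Finset.range a).filter J).card.bodd <;> simp [h] at hp
    · simp only [Finset.mem_filter, Finset.mem_range, not_and]
      omega
  have h1 := (h i hi).2 hai
  have h2 := (h' j hj).1 (by omega)
  have h3 := hr (Nat.succ_le_of_lt hij)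
  have h4 := hJ i hi
  have h5 := hJ j hj
  simp only [Nat.succ_eq_add_one] at h3
  linarith

end slabCover

/-- A finite cover of a space by contractions adapted to `𝓩`, coloured in such a way that
distinct pieces of the same colour are disjoint. -/
def HasTrackCover {X : Type*} [TopologicalSpace X] (C : Type) (𝓩 : Set (Set X)) : Prop :=
  ∃ (ι : Type) (_ : Finite ι) (color : ι → C) (N : ι → Set X) (b : ι → X) (h : ι → ℝ → X → X),
    (∀ i, IsTrackContraction 𝓩 (N i) (b i) (h i)) ∧ (⋃ i, N i) = univ ∧
    ∀ i j, i ≠ j → color i = color j → Disjoint (N i) (N j)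

lemma HasTrackCover.prod_real {X : Type*} [TopologicalSpace X] {C : Type} {𝓩 : Set (Set X)}
    (hc : HasTrackCover C 𝓩) {M : ℕ} {ρ : ℕ → X → ℝ} (hρc : ∀ i, Continuous (ρ i))
    (hρm : ∀ i x, ρ i x ≤ ρ (i + 1) x) (hρM : ∀ i x, M ≤ i → ρ i x = ρ M x)
    {𝓩' : Set (Set (X × ℝ))}
    (hZ : ∀ Z ∈ 𝓩', Z = univ ∨ ∀ p ∈ Z, ∃ i, ρ i p.1 = p.2)
    (hγ : ∀ γ : ℝ → X, ContinuousOn γ (Icc 0 1) →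
      (∀ Z ∈ 𝓩, ∀ t ∈ Ico (0 : ℝ) 1, γ t ∈ Z ↔ γ 0 ∈ Z) → ∀ t ∈ Ico (0 : ℝ) 1,
        (∀ i j, ρ i (γ t) = ρ j (γ t) ↔ ρ i (γ 0) = ρ j (γ 0)) ∧
        ∀ Z ∈ 𝓩', ∀ i, (γ t, ρ i (γ t)) ∈ Z ↔ (γ 0, ρ i (γ 0)) ∈ Z) :
    HasTrackCover (Bool × C) 𝓩' := by
  obtain ⟨ι, hι, color, N, b, h, hN, hU, hd⟩ := hc
  have hm : ∀ x, Monotone fun i => ρ i x := fun x => monotone_nat_of_le_succ fun i => hρm i x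
  have hcst : ∀ e, ∀ x ∈ N e, ∀ t ∈ Ico (0 : ℝ) 1,
      (∀ i j, ρ i (h e t x) = ρ j (h e t x) ↔ ρ i x = ρ j x) ∧
        ∀ Z ∈ 𝓩', ∀ i, (h e t x, ρ i (h e t x)) ∈ Z ↔ (x, ρ i x) ∈ Z := by
    intro e x hx t ht
    have := hγ (fun t => h e t x) ((hN e).continuousOn_track hx) (fun Z hZ t ht => by
      rw [(hN e).mem_iff Z hZ x hx t ht, (hN e).zero x hx]) t ht
    rwa [(hN e).zero x hx] at this
  have hρ : ∀ e, AdaptedRoots (N e) (h e) M ρ := fun e =>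
    ⟨hρc, hm, fun x i hi => hρM i x hi, fun x hx t ht => (hcst e x hx t ht).1⟩
  refine ⟨Σ e : ι, {a : Fin (M + 1) // ∀ j, (a : ℕ) = j + 1 → ρ j (b e) < ρ (j + 1) (b e)},
    inferInstance,
    fun p => (slabParity (fun i => ρ i (b p.1) < ρ (i + 1) (b p.1)) p.2.1, color p.1),
    _, _, _, fun p => (hN p.1).slab (hρ p.1) (Nat.lt_succ_iff.1 p.2.1.2) ?_, ?_, ?_⟩
  · intro Z hZ'
    exact (hZ Z hZ').imp id fun h1 => ⟨h1, fun x hx t ht => (hcst p.1 x hx t ht).2 Z hZ'⟩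
  · refine eq_univ_of_forall fun p => ?_
    obtain ⟨e, he⟩ := mem_iUnion.1 (hU.ge (mem_univ p.1))
    obtain ⟨a, ha, hj, hs⟩ := exists_inSlab (fun i => ρ i (b e) < ρ (i + 1) (b e)) M (hm p.1)
      (fun i hi => (hρ e).lt_of_lt (hN e) he hi) (fun i hi => hρM i p.1 hi) p.2
    exact mem_iUnion.2 ⟨⟨e, ⟨a, Nat.lt_succ_of_le ha⟩, hj⟩, he, hs⟩
  · rintro ⟨e, a, ha⟩ ⟨e', a', ha'⟩ hne hcol
    rw [Set.disjoint_left]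
    rintro p ⟨hp1, hp2⟩ ⟨hp1', hp2'⟩
    simp only [Prod.mk.injEq] at hcol
    simp only at hp1 hp2 hp1' hp2'
    by_cases hee : e = e'
    · subst hee
      rcases lt_trichotomy (a : ℕ) a' with hlt | heq | hlt
      · exact not_inSlab_of_lt hlt (hm p.1) (fun i hi => (hρ e).lt_of_lt (hN e) hp1 hi) ha'
          hcol.1 hp2 hp2'
      · apply hne
        obtain rfl := Fin.ext heq
        rfl
      · exact not_inSlab_of_lt hlt (hm p.1) (fun i hi => (hρ e).lt_of_lt (hN e) hp1 hi) ha
          hcol.1.symm hp2' hp2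
    · exact Set.disjoint_left.1 (hd e e' hee hcol.2) hp1 hp1'

/-- The linear change of coordinates sending the first basis vector to `v`. -/
noncomputable def shear {n : ℕ} (v : Fin (n + 1) → ℝ) :
    MvPolynomial (Fin (n + 1)) ℝ →ₐ[ℝ] MvPolynomial (Fin (n + 1)) ℝ :=
  aeval (Fin.cons (C (v 0) * X 0) fun i : Fin n => X i.succ + C (v i.succ) * X 0)

section shear
variable {n : ℕ} (v : Fin (n + 1) → ℝ)

lemma eval_shear (f : MvPolynomial (Fin (n + 1)) ℝ) (x : Fin n → ℝ) (y : ℝ) :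
    eval (Fin.cons y x : Fin (n + 1) → ℝ) (shear v f) =
      eval (Fin.cons (v 0 * y) fun i => x i + v i.succ * y : Fin (n + 1) → ℝ) f := by
  rw [shear, aeval_def, ← coe_eval₂Hom, ← RingHom.comp_apply]
  refine RingHom.congr_fun (MvPolynomial.ringHom_ext ?_ ?_) f
  · intro r
    simp
  · intro i
    refine Fin.cases ?_ (fun i => ?_) i <;> simp

lemma isHomogeneous_shear {f : MvPolynomial (Fin (n + 1)) ℝ} {m : ℕ} (hf : f.IsHomogeneous m) :
    (shear v f).IsHomogeneous m := by
  rw [← one_mul m]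
  refine hf.aeval (n := 1) _ fun i => ?_
  refine Fin.cases ?_ (fun i => ?_) i
  · simpa using isHomogeneous_C_mul_X (v 0) 0
  · simpa using (isHomogeneous_X ℝ i.succ).add (isHomogeneous_C_mul_X (v i.succ) 0)

lemma eval_finSuccEquiv_shear (f : MvPolynomial (Fin (n + 1)) ℝ) (x : Fin n → ℝ) (y : ℝ) :
    (((finSuccEquiv ℝ n (shear v f)).map (eval x)).eval y) =
      eval (Fin.cons (v 0 * y) fun i => x i + v i.succ * y : Fin (n + 1) → ℝ) f := by
  rw [← eval_eq_eval_mv_eval', eval_shear]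

lemma coeff_finSuccEquiv_eq_zero {f : MvPolynomial (Fin (n + 1)) ℝ} {i : ℕ}
    (h : f.totalDegree < i) : (finSuccEquiv ℝ n f).coeff i = 0 := by
  by_contra hi
  have := totalDegree_coeff_finSuccEquiv_add_le f i hi
  omega

variable {v}

lemma coeff_finSuccEquiv_shear {f : MvPolynomial (Fin (n + 1)) ℝ} {m : ℕ}
    (hf : f.IsHomogeneous m) : (finSuccEquiv ℝ n (shear v f)).coeff m = C (eval v f) := by
  have hs := isHomogeneous_shear v hf
  have h0 := hs.finSuccEquiv_coeff_isHomogeneous m 0 (by omega)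
  obtain ⟨c, hc⟩ : ∃ c, (finSuccEquiv ℝ n (shear v f)).coeff m = C c :=
    ⟨_, totalDegree_eq_zero_iff_eq_C.1 (Nat.le_zero.1 h0.totalDegree_le)⟩
  rw [hc]
  congr 1
  have h1 := eval_finSuccEquiv_shear v f 0 1
  have h2 : (Fin.cons (v 0 * 1) fun i => (0 : Fin n → ℝ) i + v i.succ * 1 : Fin (n + 1) → ℝ) =
      v := by
    ext i
    refine Fin.cases ?_ (fun i => ?_) i <;> simp
  rw [h2] at h1
  rw [← h1, Polynomial.eval_eq_sum_range' (n := m + 1)]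
  · rw [Finset.sum_eq_single m]
    · simp [hc]
    · intro j hj hjm
      have hjm' : j < m := by
        have := Finset.mem_range.1 hj
        omega
      have h3 := hs.finSuccEquiv_coeff_isHomogeneous j (m - j) (by omega)
      have h4 : constantCoeff ((finSuccEquiv ℝ n (shear v f)).coeff j) = 0 :=
        h3.coeff_eq_zero (by simp; omega)
      simp [h4]
    · simp
  · refine Nat.lt_succ_of_le ((Polynomial.natDegree_map_le).trans ?_)
    refine Polynomial.natDegree_le_iff_coeff_eq_zero.2 fun i hi => ?_
    exact coeff_finSuccEquiv_eq_zero (hs.totalDegree_le.trans_lt hi)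

lemma constLead_shear {f : MvPolynomial (Fin (n + 1)) ℝ}
    (hv : eval v (homogeneousComponent f.totalDegree f) ≠ 0) :
    ConstLead (finSuccEquiv ℝ n (shear v f)) := by
  have hco : ∀ i, f.totalDegree ≤ i → (finSuccEquiv ℝ n (shear v f)).coeff i =
      if i = f.totalDegree then C (eval v (homogeneousComponent f.totalDegree f)) else 0 := by
    intro i hi
    have h1 : (finSuccEquiv ℝ n (shear v f)).coeff i = ∑ j ∈ Finset.range (f.totalDegree + 1),
        (finSuccEquiv ℝ n (shear v (homogeneousComponent j f))).coeff i := by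
      conv_lhs => rw [← sum_homogeneousComponent f]
      simp only [map_sum, Polynomial.finsetSum_coeff]
    have h2 : ∀ j, j < i →
        (finSuccEquiv ℝ n (shear v (homogeneousComponent j f))).coeff i = 0 := fun j hj =>
      coeff_finSuccEquiv_eq_zero
        ((isHomogeneous_shear v (homogeneousComponent_isHomogeneous j f)).totalDegree_le.trans_lt
          hj)
    rw [h1]
    split_ifs with h
    · subst h
      rw [Finset.sum_range_succ, Finset.sum_eq_zero fun j hj => h2 j (Finset.mem_range.1 hj),
        zero_add]
      exact coeff_finSuccEquiv_shear (homogeneousComponent_isHomogeneous _ f)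
    · exact Finset.sum_eq_zero fun j hj => h2 j (by
        have := Finset.mem_range.1 hj
        omega)
  have hd : (finSuccEquiv ℝ n (shear v f)).natDegree = f.totalDegree := by
    refine Polynomial.natDegree_eq_of_le_of_coeff_ne_zero
      (Polynomial.natDegree_le_iff_coeff_eq_zero.2 fun i hi => ?_) ?_
    · rw [hco i hi.le, if_neg hi.ne']
    · rw [hco _ le_rfl, if_pos rfl]
      exact fun h => hv ((map_eq_zero_iff _ (C_injective (Fin n) ℝ)).1 h)
  exact ⟨_, hv, by rw [Polynomial.leadingCoeff, hd, hco _ le_rfl, if_pos rfl]⟩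

end shear

lemma homogeneousComponent_totalDegree_ne_zero {n : ℕ} {f : MvPolynomial (Fin n) ℝ}
    (hf : f ≠ 0) : homogeneousComponent f.totalDegree f ≠ 0 := by
  obtain ⟨m, hm, hm'⟩ := Finset.exists_mem_eq_sup f.support
    (Finset.nonempty_iff_ne_empty.2 fun h => hf (support_eq_empty.1 h)) fun s => s.degree
  intro h0
  have h1 : f.totalDegree = m.degree := by
    rw [← hm', totalDegree]
    rfl
  have := congrArg (coeff m) h0
  rw [coeff_homogeneousComponent, if_pos h1.symm] at this
  exact (mem_support_iff.1 hm) (by simpa using this)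

/-- A direction in which finitely many nonzero polynomials all have constant leading
coefficient. -/
lemma exists_direction {n : ℕ} (𝓕 : Finset (MvPolynomial (Fin (n + 1)) ℝ)) :
    ∃ v : Fin (n + 1) → ℝ, v 0 ≠ 0 ∧
      ∀ f ∈ 𝓕, f ≠ 0 → ConstLead (finSuccEquiv ℝ n (shear v f)) := by
  classical
  have h0 : X 0 * ∏ f ∈ 𝓕.filter (· ≠ 0), homogeneousComponent f.totalDegree f ≠ 0 :=
    mul_ne_zero (X_ne_zero 0) (Finset.prod_ne_zero_iff.2 fun f hf =>
      homogeneousComponent_totalDegree_ne_zero (Finset.mem_filter.1 hf).2)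
  obtain ⟨v, hv⟩ : ∃ v, eval v (X 0 * ∏ f ∈ 𝓕.filter (· ≠ 0),
      homogeneousComponent f.totalDegree f) ≠ 0 := by
    by_contra hno
    push Not at hno
    exact h0 (MvPolynomial.funext fun v => by simpa using hno v)
  rw [map_mul, eval_X, map_prod] at hv
  refine ⟨v, left_ne_zero_of_mul hv, fun f hf hf0 => constLead_shear ?_⟩
  exact Finset.prod_ne_zero_iff.1 (right_ne_zero_of_mul hv) f (Finset.mem_filter.2 ⟨hf, hf0⟩)

/-- The linear homeomorphism underlying `shear`. -/
noncomputable def shearHomeo {n : ℕ} (v : Fin (n + 1) → ℝ) (hv : v 0 ≠ 0) :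
    (Fin n → ℝ) × ℝ ≃ₜ (Fin (n + 1) → ℝ) where
  toFun p := Fin.cons (v 0 * p.2) fun i => p.1 i + v i.succ * p.2
  invFun z := (fun i => z i.succ - v i.succ * (z 0 / v 0), z 0 / v 0)
  left_inv p := by
    ext1
    · ext i
      simp [mul_div_cancel_left₀ _ hv]
    · simp [mul_div_cancel_left₀ _ hv]
  right_inv z := by
    ext i
    refine Fin.cases ?_ (fun i => ?_) i
    · simp [mul_div_cancel₀ _ hv]
    · simp
  continuous_toFun := by
    refine continuous_pi fun i => ?_
    refine Fin.cases ?_ (fun i => ?_) i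
    · simp only [Fin.cons_zero]; fun_prop
    · simp only [Fin.cons_succ]; fun_prop
  continuous_invFun := by fun_prop

lemma IsTrackContraction.image {X Y : Type*} [TopologicalSpace X] [TopologicalSpace Y]
    {𝓩 : Set (Set X)} {N : Set X} {b : X} {h : ℝ → X → X} (hN : IsTrackContraction 𝓩 N b h)
    (φ : X ≃ₜ Y) {𝓩' : Set (Set Y)} (hZ : ∀ Z ∈ 𝓩', φ ⁻¹' Z ∈ 𝓩) :
    IsTrackContraction 𝓩' (φ '' N) (φ b) (fun t y => φ (h t (φ.symm y))) where
  isClosed := φ.isClosed_image.2 hN.isClosed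
  continuousOn := by
    refine φ.continuous.comp_continuousOn (hN.continuousOn.comp
      (f := fun z : ℝ × Y => (z.1, φ.symm z.2)) (by fun_prop) ?_)
    rintro ⟨t, y⟩ ⟨ht, x, hx, rfl⟩
    exact ⟨ht, by simpa using hx⟩
  mapsTo := by
    rintro _ ⟨x, hx, rfl⟩ t ht
    exact ⟨_, hN.mapsTo x hx t ht, by simp⟩
  zero := by
    rintro _ ⟨x, hx, rfl⟩
    simp [hN.zero x hx]
  one := by
    rintro _ ⟨x, hx, rfl⟩
    simp [hN.one x hx]
  center_mem := ⟨b, hN.center_mem, rfl⟩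
  center t ht := by simp [hN.center t ht]
  injOn := by
    rintro _ ⟨x, hx, rfl⟩ hne s hs t ht hst
    simp only [Homeomorph.symm_apply_apply, EmbeddingLike.apply_eq_iff_eq] at hst
    exact hN.injOn x hx (fun h => hne (by rw [h])) hs ht hst
  mem_iff := by
    rintro Z hZ' _ ⟨x, hx, rfl⟩ t ht
    simpa using hN.mem_iff _ (hZ Z hZ') x hx t ht

lemma HasTrackCover.image {X Y : Type*} [TopologicalSpace X] [TopologicalSpace Y]
    {C D : Type} {𝓩 : Set (Set X)} (hc : HasTrackCover C 𝓩) (φ : X ≃ₜ Y) {e : C → D}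
    (he : Function.Injective e) {𝓩' : Set (Set Y)} (hZ : ∀ Z ∈ 𝓩', φ ⁻¹' Z ∈ 𝓩) :
    HasTrackCover D 𝓩' := by
  obtain ⟨ι, hι, color, N, b, h, hN, hU, hd⟩ := hc
  refine ⟨ι, hι, fun i => e (color i), _, _, _, fun i => (hN i).image φ hZ, ?_, ?_⟩
  · rw [← image_iUnion, hU, image_univ, φ.surjective.range_eq]
  · intro i j hij hcol
    exact (disjoint_image_iff φ.injective).2 (hd i j hij (he hcol))

/-- Finitely many polynomials have an adapted cover of `ℝ^n` with `2 ^ n` colours. -/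
theorem hasTrackCover_zeroSets (n : ℕ) (𝓕 : Finset (MvPolynomial (Fin n) ℝ)) :
    HasTrackCover (Fin n → Bool) ((fun f => {x : Fin n → ℝ | eval x f = 0}) '' 𝓕) := by
  classical
  induction n with
  | zero =>
    refine ⟨Unit, inferInstance, fun _ => 0, fun _ => univ, fun _ => 0, fun _ _ x => x,
      fun _ => ⟨isClosed_univ, by fun_prop, fun _ _ _ _ => mem_univ _, fun _ _ => rfl,
        fun _ _ => Subsingleton.elim _ _, mem_univ _, fun _ _ => rfl,
        fun x _ hx => absurd (Subsingleton.elim _ _) hx, fun _ _ _ _ _ _ => Iff.rfl⟩,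
      by simp [iUnion_const], fun i j hij => absurd (Subsingleton.elim _ _) hij⟩
  | succ n ih =>
    obtain ⟨v, hv, hlead⟩ := exists_direction 𝓕
    set Fs := (𝓕.filter (· ≠ 0)).image fun f => finSuccEquiv ℝ n (shear v f) with hFs
    obtain ⟨G, M, ρ, h1, h2, h3, h4, h5⟩ := exists_root_functions Fs (by
      intro g hg
      obtain ⟨f, hf, rfl⟩ := Finset.mem_image.1 hg
      exact hlead f (Finset.mem_filter.1 hf).1 (Finset.mem_filter.1 hf).2)
    have hmem : ∀ f ∈ 𝓕, f ≠ 0 → finSuccEquiv ℝ n (shear v f) ∈ Fs := fun f hf h0 =>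
      Finset.mem_image_of_mem _ (Finset.mem_filter.2 ⟨hf, h0⟩)
    have key := (ih G).prod_real h1 h2 h3
      (𝓩' := (fun f => {p : (Fin n → ℝ) × ℝ | eval (shearHomeo v hv p) f = 0}) '' 𝓕) ?_ ?_
    · refine key.image (shearHomeo v hv) (e := fun p => Fin.cons p.1 p.2) ?_ ?_
      · rintro ⟨a, b⟩ ⟨a', b'⟩ h
        obtain ⟨rfl, rfl⟩ := Fin.cons_inj.1 h
        rfl
      · rintro _ ⟨f, hf, rfl⟩
        exact ⟨f, hf, rfl⟩
    · rintro _ ⟨f, hf, rfl⟩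
      by_cases h0 : f = 0
      · left
        simp [h0]
      · right
        rintro ⟨x, y⟩ hp
        refine h4 _ (hmem f hf h0) x y ?_
        rw [eval_finSuccEquiv_shear]
        exact hp
    · intro γ hγ hZ t ht
      obtain ⟨h6, h7⟩ := h5 γ hγ (fun g hg t ht => hZ _ ⟨g, hg, rfl⟩ t ht) t ht
      refine ⟨h6, ?_⟩
      rintro _ ⟨f, hf, rfl⟩ i
      by_cases h0 : f = 0
      · simp [h0]
      · have := h7 _ (hmem f hf h0) i
        rw [eval_finSuccEquiv_shear, eval_finSuccEquiv_shear] at this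
        exact this

section gluing
variable {X : Type*} [TopologicalSpace X]

/-- A set which deforms inside itself onto a map factoring through the line is contractible. -/
lemma contractibleSpace_of_deformation {Y : Set X} {F : ℝ → X → X}
    (hF : ContinuousOn (fun z : ℝ × X => F z.1 z.2) (Icc 0 1 ×ˢ Y))
    (hFY : ∀ x ∈ Y, ∀ t ∈ Icc (0 : ℝ) 1, F t x ∈ Y) (hF0 : ∀ x ∈ Y, F 0 x = x)
    {g : X → ℝ} (hg : ContinuousOn g Y) {w : ℝ → X} (hw : Continuous w) (hwY : ∀ τ, w τ ∈ Y)
    (hF1 : ∀ x ∈ Y, F 1 x = w (g x)) : ContractibleSpace Y := by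
  rw [contractible_iff_id_nullhomotopic]
  let G : C(Y, ℝ) := ⟨fun x => g x, continuousOn_iff_continuous_domRestrict.1 hg⟩
  let W : C(ℝ, Y) := ⟨fun τ => ⟨w τ, hwY τ⟩, by fun_prop⟩
  have h1 : (ContinuousMap.id Y).Homotopic (W.comp G) := by
    refine ⟨⟨⟨fun p => ⟨F p.1 p.2, hFY p.2 p.2.2 p.1 p.1.2⟩, ?_⟩, ?_, ?_⟩⟩
    · refine Continuous.subtype_mk ?_ _
      exact hF.comp_continuous (f := fun p : unitInterval × Y => ((p.1 : ℝ), (p.2 : X)))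
        (by fun_prop) fun p => ⟨p.1.2, p.2.2⟩
    · intro x
      exact Subtype.ext (hF0 x x.2)
    · intro x
      exact Subtype.ext (hF1 x x.2)
  have h2 : (W.comp G).Nullhomotopic := by
    have := (id_nullhomotopic ℝ).comp_right W
    rw [ContinuousMap.comp_id] at this
    exact this.comp_left G
  obtain ⟨y, hy⟩ := h2
  exact ⟨y, h1.trans hy⟩

/-- A contraction of a contractible subset. -/
lemma exists_contraction {A : Set X} (hA : ContractibleSpace A) :
    ∃ (c : ℝ → X → X) (p : X), ContinuousOn (fun z : ℝ × X => c z.1 z.2) (univ ×ˢ A) ∧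
      (∀ x ∈ A, ∀ t, c t x ∈ A) ∧ (∀ x ∈ A, c 0 x = x) ∧ ∀ x ∈ A, c 1 x = p := by
  classical
  obtain ⟨p, ⟨H⟩⟩ := contractible_iff_id_nullhomotopic (Y := A) |>.1 hA
  refine ⟨fun t x => if h : x ∈ A then H (projIcc 0 1 zero_le_one t, ⟨x, h⟩) else x, p,
    ?_, ?_, ?_, ?_⟩
  · rw [continuousOn_iff_continuous_domRestrict]
    have : Continuous fun z : (univ ×ˢ A : Set (ℝ × X)) =>
        (H (projIcc 0 1 zero_le_one z.1.1, ⟨z.1.2, z.2.2⟩) : X) := by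
      refine continuous_subtype_val.comp (H.continuous.comp ?_)
      exact (continuous_projIcc.comp (by fun_prop)).prodMk
        (Continuous.subtype_mk (by fun_prop) _)
    refine this.congr fun z => ?_
    simp only [domRestrict_apply]
    rw [dif_pos z.2.2]
  · intro x hx t
    simp only [dif_pos hx]
    exact Subtype.coe_prop _
  · intro x hx
    simp only [dif_pos hx, projIcc_left]
    exact congrArg Subtype.val (H.apply_zero ⟨x, hx⟩)
  · intro x hx
    simp only [dif_pos hx, projIcc_right]
    exact congrArg Subtype.val (H.apply_one ⟨x, hx⟩)

variable [T2Space X]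

lemma continuousOn_invFunOn_arc {e : ℝ → X} (he : ContinuousOn e (Icc 0 1))
    (hinj : InjOn e (Icc 0 1)) :
    ContinuousOn (Function.invFunOn e (Icc 0 1)) (e '' Icc 0 1) := by
  rw [continuousOn_iff_isClosed]
  intro T hT
  refine ⟨e '' (Icc 0 1 ∩ T), ?_, ?_⟩
  · exact ((isCompact_Icc.inter_right hT).image_of_continuousOn
      (he.mono inter_subset_left)).isClosed
  · ext x
    constructor
    · rintro ⟨h1, s, hs, rfl⟩
      refine ⟨⟨s, ⟨hs, ?_⟩, rfl⟩, s, hs, rfl⟩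
      rw [mem_preimage, hinj.leftInvOn_invFunOn hs] at h1
      exact h1
    · rintro ⟨⟨s, ⟨hs, hsT⟩, rfl⟩, h2⟩
      refine ⟨?_, h2⟩
      rw [mem_preimage, hinj.leftInvOn_invFunOn hs]
      exact hsT

/-- Two disjoint closed contractible sets joined by an arc form a contractible set. -/
theorem contractibleSpace_union_arc {A B : Set X} (hA : IsClosed A) (hB : IsClosed B)
    (hAc : ContractibleSpace A) (hBc : ContractibleSpace B) (hAB : Disjoint A B)
    {e : ℝ → X} (he : ContinuousOn e (Icc 0 1)) (hinj : InjOn e (Icc 0 1))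
    (he0 : e 0 ∈ A) (he1 : e 1 ∈ B) (heA : ∀ t ∈ Icc (0 : ℝ) 1, e t ∈ A → t = 0)
    (heB : ∀ t ∈ Icc (0 : ℝ) 1, e t ∈ B → t = 1) :
    ContractibleSpace (A ∪ e '' Icc 0 1 ∪ B : Set X) := by
  classical
  obtain ⟨c, p, hc, hcA, hc0, hc1⟩ := exists_contraction hAc
  obtain ⟨c', p', hc', hcB, hc0', hc1'⟩ := exists_contraction hBc
  have hnAB : ∀ x ∈ A, x ∉ B := fun x hx hx' => Set.disjoint_left.1 hAB hx hx'
  set E := e '' Icc 0 1 with hE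
  have hEc : IsClosed E := (isCompact_Icc.image_of_continuousOn he).isClosed
  -- the path running through the whole configuration
  set w : ℝ → X := fun τ => if τ ≤ 0 then c (-τ) (e 0) else
    if τ ≤ 1 then e (projIcc 0 1 zero_le_one τ) else c' (τ - 1) (e 1) with hw
  have hw1 : ∀ τ ≤ 0, w τ = c (-τ) (e 0) := fun τ h => if_pos h
  have hw2 : ∀ τ, 0 ≤ τ → τ ≤ 1 → w τ = e τ := by
    intro τ h1 h2
    rcases h1.eq_or_lt with rfl | h1
    · rw [hw1 0 le_rfl, neg_zero, hc0 _ he0]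
    · simp only [hw, if_neg (not_le.2 h1), if_pos h2]
      rw [projIcc_of_mem _ ⟨h1.le, h2⟩]
  have hw3 : ∀ τ, 1 ≤ τ → w τ = c' (τ - 1) (e 1) := by
    intro τ h1
    rcases h1.eq_or_lt with rfl | h1
    · rw [hw2 1 zero_le_one le_rfl, sub_self, hc0' _ he1]
    · simp only [hw, if_neg (not_le.2 h1), if_neg (not_le.2 (zero_lt_one.trans h1))]
  have hwc : Continuous w := by
    have h1 : Continuous fun τ : ℝ => c (-τ) (e 0) :=
      hc.comp_continuous (f := fun τ : ℝ => (-τ, e 0)) (by fun_prop) fun τ => ⟨mem_univ _, he0⟩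
    have h2 : Continuous fun τ : ℝ => c' (τ - 1) (e 1) :=
      hc'.comp_continuous (f := fun τ : ℝ => (τ - 1, e 1)) (by fun_prop)
        fun τ => ⟨mem_univ _, he1⟩
    have h3 : Continuous fun τ : ℝ => e (projIcc 0 1 zero_le_one τ) :=
      he.comp_continuous (continuous_subtype_val.comp continuous_projIcc)
        fun τ => Subtype.coe_prop _
    refine Continuous.if_le h1 (Continuous.if_le h3 h2 continuous_id continuous_const ?_)
      continuous_id continuous_const ?_
    · rintro τ rfl
      rw [sub_self, hc0' _ he1, projIcc_right]
    · rintro τ rfl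
      rw [if_pos zero_le_one, neg_zero, hc0 _ he0, projIcc_left]
  have hwY : ∀ τ, w τ ∈ A ∪ E ∪ B := by
    intro τ
    rcases le_total τ 0 with h | h
    · rw [hw1 τ h]
      exact Or.inl (Or.inl (hcA _ he0 _))
    rcases le_total τ 1 with h' | h'
    · rw [hw2 τ h h']
      exact Or.inl (Or.inr ⟨τ, ⟨h, h'⟩, rfl⟩)
    · rw [hw3 τ h']
      exact Or.inr (hcB _ he1 _)
  -- the height function
  set g : X → ℝ := fun x => if x ∈ A then 0 else if x ∈ B then 1 else
    Function.invFunOn e (Icc 0 1) x with hg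
  have hgA : ∀ x ∈ A, g x = 0 := fun x hx => if_pos hx
  have hgB : ∀ x ∈ B, g x = 1 := fun x hx => by
    simp only [hg, if_neg fun h => hnAB x h hx, if_pos hx]
  have hgE' : ∀ s ∈ Icc (0 : ℝ) 1, g (e s) = s := by
    intro s hs
    by_cases h1 : e s ∈ A
    · rw [hgA _ h1, heA s hs h1]
    by_cases h2 : e s ∈ B
    · rw [hgB _ h2, heB s hs h2]
    · simp only [hg, if_neg h1, if_neg h2]
      exact hinj.leftInvOn_invFunOn hs
  have hgE : EqOn g (Function.invFunOn e (Icc 0 1)) E := by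
    rintro _ ⟨s, hs, rfl⟩
    rw [hgE' s hs, hinj.leftInvOn_invFunOn hs]
  have hgc : ContinuousOn g (A ∪ E ∪ B) := by
    refine ContinuousOn.union_of_isClosed (ContinuousOn.union_of_isClosed ?_ ?_ hA hEc) ?_
      (hA.union hEc) hB
    · exact continuousOn_const.congr hgA
    · exact (continuousOn_invFunOn_arc he hinj).congr hgE
    · exact continuousOn_const.congr hgB
  set F : ℝ → X → X := fun t x => if x ∈ A then c t x else if x ∈ B then c' t x else
    w (-t + g x * (1 + 2 * t)) with hF
  have hFA : ∀ t, ∀ x ∈ A, F t x = c t x := fun t x hx => if_pos hx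
  have hFB : ∀ t, ∀ x ∈ B, F t x = c' t x := fun t x hx => by
    simp only [hF, if_neg fun h => hnAB x h hx, if_pos hx]
  have hFE : ∀ t, 0 ≤ t → ∀ x ∈ E, F t x = w (-t + g x * (1 + 2 * t)) := by
    rintro t ht _ ⟨s, hs, rfl⟩
    by_cases h1 : e s ∈ A
    · rw [hFA t _ h1, hgA _ h1, hw1 _ (by linarith), heA s hs h1]
      congr 1
      ring
    by_cases h2 : e s ∈ B
    · rw [hFB t _ h2, hgB _ h2, hw3 _ (by linarith), heB s hs h2]
      congr 1
      ring
    · simp only [hF, if_neg h1, if_neg h2]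
  refine contractibleSpace_of_deformation (F := F) ?_ ?_ ?_ (g := fun x => -1 + g x * 3)
    (by fun_prop) hwc hwY ?_
  · rw [prod_union, prod_union]
    refine ContinuousOn.union_of_isClosed (ContinuousOn.union_of_isClosed ?_ ?_
      (isClosed_Icc.prod hA) (isClosed_Icc.prod hEc)) ?_
      ((isClosed_Icc.prod hA).union (isClosed_Icc.prod hEc)) (isClosed_Icc.prod hB)
    · exact (hc.mono (prod_mono (subset_univ _) le_rfl)).congr fun z hz => hFA _ _ hz.2
    · have h1 : ContinuousOn (fun z : ℝ × X => g z.2) (Icc (0 : ℝ) 1 ×ˢ E) :=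
        (hgc.mono fun x hx => Or.inl (Or.inr hx)).comp continuousOn_snd fun z hz => hz.2
      refine ContinuousOn.congr (f := fun z : ℝ × X => w (-z.1 + g z.2 * (1 + 2 * z.1))) ?_
        fun z hz => hFE _ hz.1.1 _ hz.2
      have h2 : ContinuousOn (fun z : ℝ × X => -z.1) (Icc (0 : ℝ) 1 ×ˢ E) := by fun_prop
      have h3 : ContinuousOn (fun z : ℝ × X => 1 + 2 * z.1) (Icc (0 : ℝ) 1 ×ˢ E) := by fun_prop
      exact hwc.comp_continuousOn (h2.add (h1.mul h3))
    · exact (hc'.mono (prod_mono (subset_univ _) le_rfl)).congr fun z hz => hFB _ _ hz.2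
  · rintro x ((hx | hx) | hx) t ht
    · rw [hFA t x hx]
      exact Or.inl (Or.inl (hcA x hx t))
    · rw [hFE t ht.1 x hx]
      exact hwY _
    · rw [hFB t x hx]
      exact Or.inr (hcB x hx t)
  · rintro x ((hx | hx) | hx)
    · rw [hFA 0 x hx, hc0 x hx]
    · rw [hFE 0 le_rfl x hx]
      obtain ⟨s, hs, rfl⟩ := hx
      rw [hgE' s hs, hw2 _ (by linarith [hs.1]) (by linarith [hs.2])]
      congr 1
      ring
    · rw [hFB 0 x hx, hc0' x hx]
  · rintro x ((hx | hx) | hx)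
    · rw [hFA 1 x hx, hgA x hx, hw1 _ (by norm_num), hc1 x hx,
        show (-(-1 + 0 * 3) : ℝ) = 1 by norm_num, hc1 _ he0]
    · rw [hFE 1 zero_le_one x hx]
      congr 1
      ring
    · rw [hFB 1 x hx, hgB x hx, hw3 _ (by norm_num), hc1' x hx,
        show (-1 + 1 * 3 - 1 : ℝ) = 1 by norm_num, hc1' _ he1]

end gluing

section merging
variable {X : Type*} [TopologicalSpace X] [T2Space X]

lemma contractibleSpace_union_subarc {A B : Set X} (hA : IsClosed A) (hB : IsClosed B)
    (hAc : ContractibleSpace A) (hBc : ContractibleSpace B) (hAB : Disjoint A B)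
    {e : ℝ → X} {a b : ℝ} (hab : a < b) (he : ContinuousOn e (Icc a b))
    (hinj : InjOn e (Icc a b)) (he0 : e a ∈ A) (he1 : e b ∈ B)
    (heA : ∀ t ∈ Icc a b, e t ∈ A → t = a) (heB : ∀ t ∈ Icc a b, e t ∈ B → t = b) :
    ContractibleSpace (A ∪ e '' Icc a b ∪ B : Set X) := by
  have him : (fun s : ℝ => a + s * (b - a)) '' Icc 0 1 = Icc a b := by
    rw [← segment_eq_Icc hab.le, segment_eq_image']
    rfl
  have hmaps : MapsTo (fun s : ℝ => a + s * (b - a)) (Icc 0 1) (Icc a b) := by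
    rw [← him]
    exact mapsTo_image _ _
  have hi : Function.Injective fun s : ℝ => a + s * (b - a) := fun s t hst =>
    mul_right_cancel₀ (sub_pos.2 hab).ne' (add_left_cancel hst)
  have := contractibleSpace_union_arc (e := fun s => e (a + s * (b - a))) hA hB hAc hBc hAB
    (he.comp (by fun_prop) hmaps) (hinj.comp hi.injOn hmaps) (by simpa using he0)
    (by simpa using he1)
    (fun s hs h => hi ((heA _ (hmaps hs) h).trans (by ring)))
    (fun s hs h => hi ((heB _ (hmaps hs) h).trans (by ring)))
  rwa [← image_image e (fun s : ℝ => a + s * (b - a)), him] at this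

omit [T2Space X] in
lemma exists_last_mem {A : Set X} (hA : IsClosed A) {e : ℝ → X} {b : ℝ} (hb : 0 ≤ b)
    (he : ContinuousOn e (Icc 0 b)) (he0 : e 0 ∈ A) :
    ∃ a ∈ Icc 0 b, e a ∈ A ∧ ∀ t ∈ Icc a b, e t ∈ A → t = a := by
  have hc : IsCompact (Icc 0 b ∩ e ⁻¹' A) :=
    isCompact_Icc.of_isClosed_subset (he.preimage_isClosed_of_isClosed isClosed_Icc hA)
      inter_subset_left
  obtain ⟨a, ha, hmax⟩ := hc.exists_isGreatest ⟨0, ⟨le_rfl, hb⟩, he0⟩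
  exact ⟨a, ha.1, ha.2, fun t ht h => le_antisymm (hmax ⟨⟨ha.1.1.trans ht.1, ht.2⟩, h⟩) ht.1⟩

lemma exists_extend_to_point {A : Set X} (hA : IsClosed A) (hAc : ContractibleSpace A)
    {e : ℝ → X} (he : ContinuousOn e (Icc 0 1)) (hinj : InjOn e (Icc 0 1)) (he0 : e 0 ∈ A) :
    ∃ A' : Set X, IsClosed A' ∧ ContractibleSpace A' ∧ A ⊆ A' ∧ e 1 ∈ A' ∧
      A' ⊆ A ∪ e '' Icc 0 1 := by
  by_cases h1 : e 1 ∈ A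
  · exact ⟨A, hA, hAc, le_rfl, h1, subset_union_left⟩
  obtain ⟨a, ha, haA, hlast⟩ := exists_last_mem hA zero_le_one he he0
  have ha1 : a < 1 := lt_of_le_of_ne ha.2 fun h => h1 (h ▸ haA)
  have hsub : Icc a 1 ⊆ Icc 0 1 := Icc_subset_Icc_left ha.1
  have hc : IsClosed (e '' Icc a 1) :=
    (isCompact_Icc.image_of_continuousOn (he.mono hsub)).isClosed
  have key := contractibleSpace_union_subarc hA isClosed_singleton hAc
    (inferInstance : ContractibleSpace ({e 1} : Set X)) (disjoint_singleton_right.2 h1) ha1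
    (he.mono hsub) (hinj.mono hsub) haA rfl hlast
    (fun t ht h => hinj (hsub ht) ⟨zero_le_one, le_rfl⟩ h)
  refine ⟨_, (hA.union hc).union isClosed_singleton, key,
    fun x hx => Or.inl (Or.inl hx), Or.inr rfl, ?_⟩
  rintro x ((hx | hx) | rfl)
  · exact Or.inl hx
  · exact Or.inr (image_mono hsub hx)
  · exact Or.inr ⟨1, ⟨zero_le_one, le_rfl⟩, rfl⟩

lemma exists_extend_to_member {A : Set X} (hA : IsClosed A) (hAc : ContractibleSpace A)
    {e : ℝ → X} (he : ContinuousOn e (Icc 0 1)) (hinj : InjOn e (Icc 0 1)) (he0 : e 0 ∈ A)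
    {𝓑 : Finset (Set X)} (hB : ∀ B ∈ 𝓑, IsClosed B ∧ ContractibleSpace B ∧ Disjoint A B)
    (hd : (𝓑 : Set (Set X)).PairwiseDisjoint id) (hit : ∃ t ∈ Icc (0 : ℝ) 1, ∃ B ∈ 𝓑, e t ∈ B) :
    ∃ B ∈ 𝓑, ∃ A' : Set X, IsClosed A' ∧ ContractibleSpace A' ∧ A ⊆ A' ∧ B ⊆ A' ∧
      A' ⊆ A ∪ e '' Icc 0 1 ∪ B ∧ ∀ B' ∈ 𝓑, B' ≠ B → Disjoint A' B' := by
  have hU : IsClosed (⋃ B ∈ 𝓑, B) := 𝓑.finite_toSet.isClosed_biUnion fun B h => (hB B h).1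
  have hc : IsCompact (Icc 0 1 ∩ e ⁻¹' (⋃ B ∈ 𝓑, B)) :=
    isCompact_Icc.of_isClosed_subset (he.preimage_isClosed_of_isClosed isClosed_Icc hU)
      inter_subset_left
  obtain ⟨b, ⟨hb, hbU⟩, hmin⟩ := hc.exists_isLeast (by
    obtain ⟨t, ht, B, hB', hm⟩ := hit
    exact ⟨t, ht, mem_biUnion hB' hm⟩)
  obtain ⟨B, hB', hbB⟩ : ∃ B ∈ 𝓑, e b ∈ B := by simpa using hbU
  have hAb : e b ∉ A := fun h => Set.disjoint_left.1 (hB B hB').2.2 h hbB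
  have hsubb : Icc 0 b ⊆ Icc 0 1 := Icc_subset_Icc_right hb.2
  obtain ⟨a, ha, haA, hlast⟩ := exists_last_mem hA hb.1 (he.mono hsubb) he0
  have hab : a < b := lt_of_le_of_ne ha.2 fun h => hAb (h ▸ haA)
  have hsub : Icc a b ⊆ Icc 0 1 := (Icc_subset_Icc_left ha.1).trans hsubb
  have hfirst : ∀ t ∈ Icc a b, ∀ B' ∈ 𝓑, e t ∈ B' → t = b := fun t ht B' hB'' h =>
    le_antisymm ht.2 (hmin ⟨hsub ht, mem_biUnion hB'' h⟩)
  have hcl : IsClosed (e '' Icc a b) :=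
    (isCompact_Icc.image_of_continuousOn (he.mono hsub)).isClosed
  have key := contractibleSpace_union_subarc hA (hB B hB').1 hAc (hB B hB').2.1 (hB B hB').2.2
    hab (he.mono hsub) (hinj.mono hsub) haA hbB hlast fun t ht h => hfirst t ht B hB' h
  refine ⟨B, hB', _, (hA.union hcl).union (hB B hB').1, key, fun x hx => Or.inl (Or.inl hx),
    fun x hx => Or.inr hx, ?_, ?_⟩
  · rintro x ((hx | hx) | hx)
    · exact Or.inl (Or.inl hx)
    · exact Or.inl (Or.inr (image_mono hsub hx))
    · exact Or.inr hx
  · intro B' hB'' hne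
    have hBB : Disjoint B B' := hd hB' hB'' hne.symm
    rw [Set.disjoint_left] at hBB ⊢
    rintro x ((hx | ⟨t, ht, rfl⟩) | hx) hx'
    · exact Set.disjoint_left.1 (hB B' hB'').2.2 hx hx'
    · have := hfirst t ht B' hB'' hx'
      subst this
      exact hBB hbB hx'
    · exact hBB hx hx'

/-- Two points are joined by an arc inside `S`. -/
def JoinedByArc (S : Set X) (x y : X) : Prop :=
  ∃ e : ℝ → X, ContinuousOn e (Icc 0 1) ∧ InjOn e (Icc 0 1) ∧ MapsTo e (Icc 0 1) S ∧
    e 0 = x ∧ e 1 = y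

omit [T2Space X] in
lemma JoinedByArc.symm {S : Set X} {x y : X} (h : JoinedByArc S x y) : JoinedByArc S y x := by
  obtain ⟨e, h1, h2, h3, h4, h5⟩ := h
  have hm : MapsTo (fun t : ℝ => 1 - t) (Icc 0 1) (Icc 0 1) := fun t ht =>
    ⟨by linarith [ht.2], by linarith [ht.1]⟩
  exact ⟨fun t => e (1 - t), h1.comp (by fun_prop) hm,
    h2.comp (fun s _ t _ hst => sub_right_injective hst) hm, h3.comp hm, by simpa using h5,
    by simpa using h4⟩

lemma exists_merge_step {S : Set X} {x y : X} (hxy : Relation.ReflTransGen (JoinedByArc S) x y)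
    {𝓑 : Finset (Set X)} (hB : ∀ B ∈ 𝓑, IsClosed B ∧ ContractibleSpace B ∧ B ⊆ S)
    (hd : (𝓑 : Set (Set X)).PairwiseDisjoint id) (hy : ∃ B ∈ 𝓑, y ∈ B) {A : Set X}
    (hA : IsClosed A) (hAc : ContractibleSpace A) (hAS : A ⊆ S) (hxA : x ∈ A)
    (hAd : ∀ B ∈ 𝓑, Disjoint A B) :
    ∃ B ∈ 𝓑, ∃ A' : Set X, IsClosed A' ∧ ContractibleSpace A' ∧ A' ⊆ S ∧ A ⊆ A' ∧ B ⊆ A' ∧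
      ∀ B' ∈ 𝓑, B' ≠ B → Disjoint A' B' := by
  induction hxy using Relation.ReflTransGen.head_induction_on generalizing A with
  | refl =>
    obtain ⟨B, hB', hyB⟩ := hy
    exact absurd hyB (Set.disjoint_left.1 (hAd B hB') hxA)
  | head h _ ih =>
    obtain ⟨e, h1, h2, h3, rfl, rfl⟩ := h
    by_cases hit : ∃ t ∈ Icc (0 : ℝ) 1, ∃ B ∈ 𝓑, e t ∈ B
    · obtain ⟨B, hB', A', h4, h5, h6, h7, h8, h9⟩ := exists_extend_to_member hA hAc h1 h2 hxA
        (fun B h => ⟨(hB B h).1, (hB B h).2.1, hAd B h⟩) hd hit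
      exact ⟨B, hB', A', h4, h5, h8.trans (union_subset (union_subset hAS h3.image_subset)
        (hB B hB').2.2), h6, h7, h9⟩
    · obtain ⟨A', h4, h5, h6, h7, h8⟩ := exists_extend_to_point hA hAc h1 h2 hxA
      obtain ⟨B, hB', A'', h9, h10, h11, h12, h13⟩ := ih h4 h5
        (h8.trans (union_subset hAS h3.image_subset)) h7 (by
          intro B hB'
          rw [Set.disjoint_left]
          intro x hx hxB
          rcases h8 hx with hx | ⟨t, ht, rfl⟩
          · exact Set.disjoint_left.1 (hAd B hB') hx hxB
          · exact hit ⟨t, ht, B, hB', hxB⟩)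
      exact ⟨B, hB', A'', h9, h10, h11, h6.trans h12, h13⟩

/-- Finitely many disjoint closed contractible subsets of `S` linked by arcs lie in a single
closed contractible subset of `S`. -/
theorem exists_merge {S : Set X} {x : X} (m : ℕ) (𝓐 : Finset (Set X)) (hm : 𝓐.card = m + 1)
    (hA : ∀ A ∈ 𝓐, IsClosed A ∧ ContractibleSpace A ∧ A ⊆ S ∧
      ∃ a ∈ A, Relation.ReflTransGen (JoinedByArc S) x a)
    (hd : (𝓐 : Set (Set X)).PairwiseDisjoint id) :
    ∃ A' : Set X, IsClosed A' ∧ ContractibleSpace A' ∧ A' ⊆ S ∧ ∀ A ∈ 𝓐, A ⊆ A' := by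
  classical
  induction m generalizing 𝓐 with
  | zero =>
    obtain ⟨A, rfl⟩ := Finset.card_eq_one.1 hm
    obtain ⟨h1, h2, h3, -⟩ := hA A (Finset.mem_singleton_self A)
    exact ⟨A, h1, h2, h3, fun B hB => (Finset.mem_singleton.1 hB).le⟩
  | succ m ih =>
    obtain ⟨A, hA'⟩ : 𝓐.Nonempty := Finset.card_pos.1 (by omega)
    set 𝓑 := 𝓐.erase A with h𝓑
    have hcard : 𝓑.card = m + 1 := by rw [h𝓑, Finset.card_erase_of_mem hA', hm]; rfl
    obtain ⟨B₀, hB₀⟩ : 𝓑.Nonempty := Finset.card_pos.1 (by omega)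
    have hsub : 𝓑 ⊆ 𝓐 := Finset.erase_subset _ _
    obtain ⟨h1, h2, h3, a, haA, hxa⟩ := hA A hA'
    obtain ⟨-, -, -, b, hbB, hxb⟩ := hA B₀ (hsub hB₀)
    have : Std.Symm (JoinedByArc S) := ⟨fun _ _ h => h.symm⟩
    have hax : Relation.ReflTransGen (JoinedByArc S) a x :=
      Relation.ReflTransGen.stdSymm.symm _ _ hxa
    obtain ⟨B, hB, A', h4, h5, h6, h7, h8, h9⟩ := exists_merge_step (hax.trans hxb) (𝓑 := 𝓑)
      (fun B hB => ⟨(hA B (hsub hB)).1, (hA B (hsub hB)).2.1, (hA B (hsub hB)).2.2.1⟩)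
      (hd.subset (Finset.coe_subset.2 hsub)) ⟨B₀, hB₀, hbB⟩ h1 h2 h3 haA
      (fun B hB => hd hA' (hsub hB) (Finset.ne_of_mem_erase hB).symm)
    have hA'd : ∀ B' ∈ 𝓑.erase B, Disjoint A' B' := fun B' h =>
      h9 B' (Finset.mem_of_mem_erase h) (Finset.ne_of_mem_erase h)
    have hnot : A' ∉ 𝓑.erase B := fun h => by
      have := hA'd A' h
      rw [disjoint_self, bot_eq_empty] at this
      rw [this] at h7
      exact h7 haA
    obtain ⟨A'', h10, h11, h12, h13⟩ := ih (insert A' (𝓑.erase B)) (by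
        rw [Finset.card_insert_of_notMem hnot, Finset.card_erase_of_mem hB, hcard]; rfl)
      (by
        intro C hC
        rcases Finset.mem_insert.1 hC with rfl | hC
        · exact ⟨h4, h5, h6, a, h7 haA, hxa⟩
        · exact hA C (hsub (Finset.mem_of_mem_erase hC)))
      (by
        rw [Finset.coe_insert]
        refine (hd.subset fun C hC => hsub (Finset.mem_of_mem_erase hC)).insert fun C hC _ =>
          hA'd C hC)
    refine ⟨A'', h10, h11, h12, fun C hC => ?_⟩
    have hA'' := h13 A' (Finset.mem_insert_self _ _)
    by_cases hCA : C = A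
    · rw [hCA]; exact h7.trans hA''
    by_cases hCB : C = B
    · rw [hCB]; exact h8.trans hA''
    exact h13 C (Finset.mem_insert_of_mem
      (Finset.mem_erase.2 ⟨hCB, Finset.mem_erase.2 ⟨hCA, hC⟩⟩))

end merging

/-- A track contraction restricts to every closed set defined by signs of polynomials. -/
lemma IsTrackContraction.mem_of_signClosed {k : ℕ} {Ps : Finset (MvPolynomial (Fin k) ℝ)}
    {S N : Set (Fin k → ℝ)} {b : Fin k → ℝ} {h : ℝ → (Fin k → ℝ) → Fin k → ℝ}
    (hN : IsTrackContraction ((fun f => {x : Fin k → ℝ | eval x f = 0}) '' Ps) N b h)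
    (hS : SignClosed Ps S) (hSc : IsClosed S) {x : Fin k → ℝ} (hx : x ∈ N) (hxS : x ∈ S) :
    ∀ t ∈ Icc (0 : ℝ) 1, h t x ∈ S := by
  have hzero : ∀ P ∈ Ps, ∀ t ∈ Ico (0 : ℝ) 1, eval (h t x) P = 0 ↔ eval x P = 0 :=
    fun P hP t ht => hN.mem_iff _ ⟨P, hP, rfl⟩ x hx t ht
  have hcont : ∀ P : MvPolynomial (Fin k) ℝ,
      ContinuousOn (fun t => eval (h t x) P) (Icc 0 1) := fun P =>
    (MvPolynomial.continuous_eval P).comp_continuousOn (hN.continuousOn_track hx)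
  have hIco : MapsTo (fun t => h t x) (Ico 0 1) S := by
    intro t ht
    have hst : Icc 0 t ⊆ Icc (0 : ℝ) 1 := Icc_subset_Icc_right ht.2.le
    refine hS x hxS _ fun P hP => ⟨fun h0 => (hzero P hP t ht).2 h0, fun h0 => ?_, fun h0 => ?_⟩
    · by_contra hneg
      obtain ⟨s, hs, hs0⟩ := intermediate_value_Icc' ht.1 ((hcont P).mono hst)
        (show (0 : ℝ) ∈ _ from ⟨(not_le.1 hneg).le, by simpa only [hN.zero x hx] using h0.le⟩)
      exact h0.ne' ((hzero P hP s ⟨hs.1, hs.2.trans_lt ht.2⟩).1 hs0)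
    · by_contra hpos
      obtain ⟨s, hs, hs0⟩ := intermediate_value_Icc ht.1 ((hcont P).mono hst)
        (show (0 : ℝ) ∈ _ from ⟨by simpa only [hN.zero x hx] using h0.le, (not_le.1 hpos).le⟩)
      exact h0.ne ((hzero P hP s ⟨hs.1, hs.2.trans_lt ht.2⟩).1 hs0)
  have := hIco.closure_of_continuousOn (by
    rw [closure_Ico zero_ne_one]
    exact hN.continuousOn_track hx)
  rwa [closure_Ico zero_ne_one, hSc.closure_eq] at this

/-- Covering by contractible sets, with a bound in terms of the number of pieces of a clopen
partition. -/
theorem exists_cover_of_signClosed {k B : ℕ} {Ps : Finset (MvPolynomial (Fin k) ℝ)}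
    {S : Set (Fin k → ℝ)} (hS : SignClosed Ps S) (hSc : IsClosed S)
    (hB : ∀ (Q : Type) [Fintype Q] (K : Q → Set (Fin k → ℝ)), (∀ i, (K i).Nonempty) →
      (∀ i, K i ⊆ S) → (∀ i, IsClosed (K i)) → (∀ i, IsClosed (S \ K i)) →
      (∀ i j, i ≠ j → Disjoint (K i) (K j)) → Fintype.card Q ≤ B) :
    ∃ (m : ℕ) (F : Fin m → Set (Fin k → ℝ)), m ≤ 2 ^ k * B ∧ S = ⋃ i, F i ∧
      ∀ i, IsClosed (F i) ∧ ContractibleSpace (F i) := by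
  classical
  obtain ⟨ι, hι, color, N, b, h, hN, hU, hd⟩ := hasTrackCover_zeroSets k Ps
  set I := {i : ι // (S ∩ N i).Nonempty} with hI
  have hmaps : ∀ (i : ι), ∀ x ∈ S ∩ N i, ∀ t ∈ Icc (0 : ℝ) 1, h i t x ∈ S ∩ N i :=
    fun i x hx t ht => ⟨(hN i).mem_of_signClosed hS hSc hx.2 hx.1 t ht, (hN i).mapsTo x hx.2 t ht⟩
  have hb : ∀ i : I, b i ∈ S ∩ N i := by
    rintro ⟨i, x, hx⟩
    have := hmaps i x hx 1 ⟨zero_le_one, le_rfl⟩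
    rwa [(hN i).one x hx.2] at this
  have hcl : ∀ i : ι, IsClosed (S ∩ N i) := fun i => hSc.inter (hN i).isClosed
  have hcon : ∀ i : I, ContractibleSpace (S ∩ N i : Set (Fin k → ℝ)) := fun i =>
    contractibleSpace_of_deformation (F := h i) (g := fun _ => 0) (w := fun _ => b i)
      ((hN i).continuousOn.mono (prod_mono le_rfl inter_subset_right)) (hmaps i)
      (fun x hx => (hN i).zero x hx.2) continuousOn_const continuous_const (fun _ => hb i)
      (fun x hx => (hN i).one x hx.2)
  have hchain : ∀ i : I, ∀ x ∈ S ∩ N i, Relation.ReflTransGen (JoinedByArc S) x (b i) := by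
    intro i x hx
    by_cases hxb : x = b i
    · rw [hxb]
    · exact Relation.ReflTransGen.single ⟨fun t => h i t x, (hN i).continuousOn_track hx.2,
        (hN i).injOn x hx.2 hxb, fun t ht => (hmaps i x hx t ht).1, (hN i).zero x hx.2,
        (hN i).one x hx.2⟩
  have hsymm : ∀ x y, Relation.ReflTransGen (JoinedByArc S) x y →
      Relation.ReflTransGen (JoinedByArc S) y x := by
    intro x y hxy
    have : Std.Symm (JoinedByArc S) := ⟨fun _ _ h => h.symm⟩
    exact Relation.ReflTransGen.stdSymm.symm _ _ hxy
  let R : Setoid I := ⟨fun i j => Relation.ReflTransGen (JoinedByArc S) (b i) (b j),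
    fun i => Relation.ReflTransGen.refl, fun h => hsymm _ _ h, fun h h' => h.trans h'⟩
  have : Finite (Quotient R) := inferInstance
  have := Fintype.ofFinite (Quotient R)
  have := Fintype.ofFinite I
  set K : Quotient R → Set (Fin k → ℝ) := fun q =>
    ⋃ i ∈ {i : I | Quotient.mk R i = q}, S ∩ N i with hK
  have hcover : ∀ x ∈ S, ∃ i : I, x ∈ S ∩ N i := by
    intro x hx
    obtain ⟨i, hi⟩ := mem_iUnion.1 (hU.ge (mem_univ x))
    exact ⟨⟨i, x, hx, hi⟩, hx, hi⟩
  have heq : ∀ i j : I, ∀ x, x ∈ S ∩ N i → x ∈ S ∩ N j → Quotient.mk R i = Quotient.mk R j :=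
    fun i j x hi hj => Quotient.sound ((hsymm _ _ (hchain i x hi)).trans (hchain j x hj))
  have hmemK : ∀ q x, x ∈ K q ↔ ∃ i : I, Quotient.mk R i = q ∧ x ∈ S ∩ N i := by
    intro q x
    simp only [hK, mem_iUnion, mem_ofPred_eq, exists_prop]
  have hcard : Fintype.card (Quotient R) ≤ B := by
    refine hB (Quotient R) K ?_ ?_ ?_ ?_ ?_
    · intro q
      induction q using Quotient.inductionOn with
      | _ i => exact ⟨b i, (hmemK _ _).2 ⟨i, rfl, hb i⟩⟩
    · intro q x hx
      obtain ⟨i, -, hi⟩ := (hmemK q x).1 hx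
      exact hi.1
    · intro q
      exact (toFinite _).isClosed_biUnion fun i _ => hcl i
    · intro q
      have : S \ K q = ⋃ i ∈ {i : I | Quotient.mk R i ≠ q}, S ∩ N i := by
        ext x
        simp only [mem_sdiff, hmemK, mem_iUnion, mem_ofPred_eq, exists_prop]
        constructor
        · rintro ⟨hx, hno⟩
          obtain ⟨i, hi⟩ := hcover x hx
          exact ⟨i, fun h => hno ⟨i, h, hi⟩, hi⟩
        · rintro ⟨i, hi, hx⟩
          exact ⟨hx.1, fun ⟨j, hj, hx'⟩ => hi ((heq i j x hx hx').trans hj)⟩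
      rw [this]
      exact (toFinite _).isClosed_biUnion fun i _ => hcl i
    · intro q q' hne
      rw [Set.disjoint_left]
      intro x hx hx'
      obtain ⟨i, rfl, hi⟩ := (hmemK q x).1 hx
      obtain ⟨j, rfl, hj⟩ := (hmemK q' x).1 hx'
      exact hne (heq i j x hi hj)
  have hmerge : ∀ p : (Fin k → Bool) × Quotient R, ∃ A : Set (Fin k → ℝ), IsClosed A ∧
      ContractibleSpace A ∧ A ⊆ S ∧
      ∀ i : I, color i = p.1 → Quotient.mk R i = p.2 → S ∩ N i ⊆ A := by
    rintro ⟨c, q⟩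
    obtain ⟨i₀, hi₀⟩ := Quotient.exists_rep q
    by_cases hex : ∃ i : I, color i = c ∧ Quotient.mk R i = q
    · set 𝓐 : Finset (Set (Fin k → ℝ)) :=
        (Finset.univ.filter fun i : I => color i = c ∧ Quotient.mk R i = q).image
          fun i : I => S ∩ N i with h𝓐
      have hmem𝓐 : ∀ A, A ∈ 𝓐 ↔ ∃ i : I, (color i = c ∧ Quotient.mk R i = q) ∧ S ∩ N i = A := by
        intro A
        simp only [h𝓐, Finset.mem_image, Finset.mem_filter, Finset.mem_univ, true_and]
      have hne : 𝓐.Nonempty := by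
        obtain ⟨i, hi⟩ := hex
        exact ⟨_, (hmem𝓐 _).2 ⟨i, hi, rfl⟩⟩
      obtain ⟨A, h1, h2, h3, h4⟩ := exists_merge (S := S) (x := b i₀) (𝓐.card - 1) 𝓐
        (by have := hne.card_pos; omega)
        (by
          intro A hA
          obtain ⟨i, ⟨-, hi⟩, rfl⟩ := (hmem𝓐 A).1 hA
          exact ⟨hcl i, hcon i, inter_subset_left, b i, hb i,
            Quotient.exact (hi₀.trans hi.symm)⟩)
        (by
          intro A hA A' hA' hne
          obtain ⟨i, ⟨hi, -⟩, rfl⟩ := (hmem𝓐 A).1 hA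
          obtain ⟨j, ⟨hj, -⟩, rfl⟩ := (hmem𝓐 A').1 hA'
          have hij : (i : ι) ≠ j := fun h => hne (by rw [h])
          exact (hd i j hij (hi.trans hj.symm)).mono inter_subset_right inter_subset_right)
      exact ⟨A, h1, h2, h3, fun i hi hi' => h4 _ ((hmem𝓐 _).2 ⟨i, ⟨hi, hi'⟩, rfl⟩)⟩
    · exact ⟨S ∩ N i₀, hcl i₀, hcon i₀, inter_subset_left,
        fun i hi hi' => absurd ⟨i, hi, hi'⟩ hex⟩
  choose A hA1 hA2 hA3 hA4 using hmerge
  refine ⟨Fintype.card ((Fin k → Bool) × Quotient R), fun j => A ((Fintype.equivFin _).symm j),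
    ?_, ?_, fun j => ⟨hA1 _, hA2 _⟩⟩
  · rw [Fintype.card_prod]
    refine Nat.mul_le_mul (le_of_eq (by simp)) hcard
  · refine subset_antisymm (fun x hx => ?_) (iUnion_subset fun j => hA3 _)
    obtain ⟨i, hi⟩ := hcover x hx
    refine mem_iUnion.2 ⟨Fintype.equivFin _ (color i, Quotient.mk R i), ?_⟩
    rw [Equiv.symm_apply_apply]
    exact hA4 (color i, Quotient.mk R i) i rfl rfl hi

lemma signClosed_basicClosedSet {k : ℕ} {Ps : Finset (MvPolynomial (Fin k) ℝ)}
    {P : MvPolynomial (Fin k) ℝ} (hP : P ∈ Ps) (σ : SignType) :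
    SignClosed Ps (basicClosedSet P σ) := by
  intro z hz w hw
  obtain ⟨h0, h1, h2⟩ := hw P hP
  cases σ
  · exact h0 hz
  · change eval w P ≤ 0
    rcases (show eval z P ≤ 0 from hz).eq_or_lt with h | h
    exacts [(h0 h).le, h2 h]
  · change 0 ≤ eval w P
    rcases (show 0 ≤ eval z P from hz).eq_or_lt with h | h
    exacts [(h0 h.symm).ge, h1 h]

lemma isClosed_basicClosedSet {k : ℕ} (P : MvPolynomial (Fin k) ℝ) (σ : SignType) :
    IsClosed (basicClosedSet P σ) := by
  cases σ
  · exact isClosed_eq (MvPolynomial.continuous_eval P) continuous_const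
  · exact isClosed_le (MvPolynomial.continuous_eval P) continuous_const
  · exact isClosed_le continuous_const (MvPolynomial.continuous_eval P)

lemma cover_bound {k s d : ℕ} (hk : 1 ≤ k) (hs : 1 ≤ s) (hd : 2 ≤ d) :
    2 ^ k * ((2 * d + 1) ^ k * (s + 1) ^ k) ≤ s ^ ((k + 1) ^ 2) * d ^ (5 * k ^ 5) := by
  have h1 : 2 * d + 1 ≤ d ^ 3 := by nlinarith [Nat.mul_le_mul hd hd]
  have h2 : s + 1 ≤ d * s := by nlinarith
  calc 2 ^ k * ((2 * d + 1) ^ k * (s + 1) ^ k)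
      ≤ d ^ k * ((d ^ 3) ^ k * (d * s) ^ k) := by gcongr
    _ = s ^ k * d ^ (5 * k) := by ring
    _ ≤ s ^ ((k + 1) ^ 2) * d ^ (5 * k ^ 5) := by
        refine Nat.mul_le_mul (Nat.pow_le_pow_right hs (by nlinarith))
          (Nat.pow_le_pow_right (by omega) ?_)
        exact Nat.mul_le_mul_left 5 (Nat.le_self_pow (by norm_num) k)

/-- Covering by contractible sets: there is a universal constant `c > 0` such that every
`Ps`-closed set `S` contained in a sphere, where `Ps` consists of `s` polynomials of degree
at most `d` in `ℝ[X_1,…,X_k]` in strong `k`-general position, is the union of at most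
`s^{(k+1)²} · d^{c·k⁵}` closed, bounded and contractible subsets of `ℝ^k`. -/
theorem covering_by_closed_contractible_sets :
    ∃ c : ℕ, 0 < c ∧
      ∀ (k s d : ℕ) (Ps : Finset (MvPolynomial (Fin k) ℝ)),
        1 ≤ k →
        Ps.card = s →
        (∀ P ∈ Ps, P.totalDegree ≤ d) →
        -- strong k-general position: no k+1 distinct members have a common zero,
        (∀ F : Finset (MvPolynomial (Fin k) ℝ), F ⊆ Ps → F.card = k + 1 →
          ∀ x : Fin k → ℝ, ∃ Q ∈ F, eval x Q ≠ 0) →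
        -- and any k distinct members have only finitely many common zeros
        (∀ F : Finset (MvPolynomial (Fin k) ℝ), F ⊆ Ps → F.card = k →
          {x : Fin k → ℝ | ∀ Q ∈ F, eval x Q = 0}.Finite) →
        ∀ (r : ℝ), 0 < r →
        ∀ (S : Set (Fin k → ℝ))
          (nJ : ℕ) (mJ : Fin nJ → ℕ)
          (idx : ∀ j, Fin (mJ j) → MvPolynomial (Fin k) ℝ)
          (rel : ∀ j, Fin (mJ j) → SignType),
          (∀ j i, idx j i ∈ Ps) →
          S = ⋃ j, ⋂ i, basicClosedSet (idx j i) (rel j i) →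
          S ⊆ {x : Fin k → ℝ | ∑ i, x i ^ 2 = r ^ 2} →
          ∃ (N : ℕ) (F : Fin N → Set (Fin k → ℝ)),
            N ≤ s ^ ((k + 1) ^ 2) * d ^ (c * k ^ 5) ∧
            S = ⋃ i, F i ∧
            ∀ i, IsClosed (F i) ∧ Bornology.IsBounded (F i) ∧
              ContractibleSpace ↥(F i) := by
  refine ⟨5, by norm_num, ?_⟩
  intro k s d Ps hk hs hdeg hgp _ r hr S nJ mJ idx rel hidx hSeq hSr
  have hS : SignClosed Ps S := by
    intro z hz w hw
    rw [hSeq, mem_iUnion] at hz ⊢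
    obtain ⟨j, hj⟩ := hz
    refine ⟨j, mem_iInter.2 fun i => ?_⟩
    exact signClosed_basicClosedSet (hidx j i) (rel j i) z (mem_iInter.1 hj i) w hw
  have hSc : IsClosed S := by
    rw [hSeq]
    exact isClosed_iUnion_of_finite fun j => isClosed_iInter fun i => isClosed_basicClosedSet _ _
  have hSb : Bornology.IsBounded S := isBounded_of_subset_sphere hSr
  by_cases hconst : ∀ P ∈ Ps, ∀ x, eval x P = eval 0 P
  · have h0 := eq_empty_of_forall_eval_eq hr hS hSr hconst
    exact ⟨0, fun i => i.elim0, Nat.zero_le _, by rw [h0, iUnion_of_empty], fun i => i.elim0⟩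
  have hs1 : 1 ≤ s := by
    rw [← hs, Nat.one_le_iff_ne_zero]
    intro h0
    exact hconst fun P hP => by simp [Finset.card_eq_zero.1 h0] at hP
  have hd1 : 1 ≤ d := by
    rw [Nat.one_le_iff_ne_zero]
    rintro rfl
    refine hconst fun P hP x => ?_
    rw [totalDegree_eq_zero_iff_eq_C.1 (Nat.le_zero.1 (hdeg P hP))]
    simp
  rcases hd1.eq_or_lt with rfl | hd2
  · obtain ⟨hfin, hcard⟩ := card_le_of_totalDegree_le_one hk hdeg hgp hS hSr
    have := hfin.fintype
    refine ⟨Fintype.card S, fun i => {((Fintype.equivFin S).symm i : Fin k → ℝ)}, ?_, ?_,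
      fun i => ⟨isClosed_singleton, Bornology.isBounded_singleton, inferInstance⟩⟩
    · rw [← Nat.card_eq_fintype_card, Nat.card_coe_set_eq, one_pow, mul_one]
      refine hcard.trans ?_
      rw [hs]
      exact Nat.pow_le_pow_right hs1 (by nlinarith)
    · ext x
      rw [mem_iUnion]
      constructor
      · intro hx
        exact ⟨Fintype.equivFin S ⟨x, hx⟩, by simp⟩
      · rintro ⟨i, rfl⟩
        exact Subtype.coe_prop _
  · obtain ⟨m, F, hm, hF, hFi⟩ := exists_cover_of_signClosed hS hSc
      (B := (2 * d + 1) ^ k * (s + 1) ^ k) (fun Q _ K h1 h2 h3 h4 h5 => by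
        rw [← hs]
        exact card_clopen_le_of_signClosed hd2 hdeg hgp hS hSr K h1 h2 h3 h4 h5)
    exact ⟨m, F, hm.trans (cover_bound hk hs1 hd2), hF, fun i => ⟨(hFi i).1,
      hSb.subset (by rw [hF]; exact subset_iUnion F i), (hFi i).2⟩⟩
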